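/- If K is a field of characteristic zero, then T_2(E_{0*}⊗E_0) = I; that is, the 2-graded identities of E_{0*}⊗E_0 follow from the polynomials (1)–(7). -/

import Mathlib

open scoped TensorProduct

noncomputable section

namespace Paper

variable (K : Type) [Field K]

/-- The Grassmann algebra `E` of a vector space with countable basis. -/
abbrev E := ExteriorAlgebra K (ℕ →₀ K)

/-- The generators `e_i` of the Grassmann algebra (0-based indexing). -/
def eGen (i : ℕ) : E K := ExteriorAlgebra.ι K (Finsupp.single i 1)

/-- The basis monomial `e_{i_1} ⋯ e_{i_k}` of `E`, `i_1 < ⋯ < i_k`, indexed by a finite set. -/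
def eMon (s : Finset ℕ) : E K := ((s.sort (· ≤ ·)).map (eGen K)).prod

/-- The algebra `A = E ⊗ E`. -/
abbrev A := E K ⊗[K] E K

/-- The canonical basis of `E ⊗ E`, indexed by pairs of finite sets (= supports). -/
def bEE (q : Finset ℕ × Finset ℕ) : A K := eMon K q.1 ⊗ₜ[K] eMon K q.2

/-- The `ℤ₂ × ℤ₂`-degree of a canonical basis element in the canonical grading of `E ⊗ E`. -/
def gdeg (q : Finset ℕ × Finset ℕ) : ZMod 2 × ZMod 2 :=
  ((q.1.card : ZMod 2), (q.2.card : ZMod 2))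

/-- The homogeneous component of degree `g` of the canonical `ℤ₂ × ℤ₂`-grading of `E ⊗ E`. -/
def Acomp (g : ZMod 2 × ZMod 2) : Submodule K (A K) :=
  Submodule.span K { a | ∃ q, gdeg q = g ∧ a = bEE K q }

/-- Degree of a basis monomial of `E ⊗ E` in the `ℤ₂`-grading induced by weight functions
`w₁, w₂` on the generators of the two factors. -/
def wdeg (w₁ w₂ : ℕ → ZMod 2) (q : Finset ℕ × Finset ℕ) : ZMod 2 :=
  (∑ i ∈ q.1, w₁ i) + (∑ j ∈ q.2, w₂ j)

/-- Homogeneous component of degree `δ` of the `ℤ₂`-grading of `E ⊗ E` induced by weights. -/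
def Agr (w₁ w₂ : ℕ → ZMod 2) (δ : ZMod 2) : Submodule K (A K) :=
  Submodule.span K { a | ∃ q, wdeg w₁ w₂ q = δ ∧ a = bEE K q }

/-- Weights for `E_∞`:  `‖e_i‖ = 1` iff `i` is even (paper's 1-based `e_i` is our `i-1`). -/
def wInf : ℕ → ZMod 2 := fun i => if i % 2 = 1 then 1 else 0

/-- Weights for `E_{k*}`:  `‖e_i‖ = 1` for `i ≤ k`, else `0`. -/
def wKstar (k : ℕ) : ℕ → ZMod 2 := fun i => if i < k then 1 else 0

/-- Weights for `E_k`:  `‖e_i‖ = 0` for `i ≤ k`, else `1`. -/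
def wK (k : ℕ) : ℕ → ZMod 2 := fun i => if i < k then 0 else 1

/-- The `ℤ₂`-grading `E_{0*} ⊗ E_0` of `A = E ⊗ E`: `A₀ = E⊗E⁰`, `A₁ = E⊗E¹`. -/
def A0star (δ : ZMod 2) : Submodule K (A K) := Agr K (wKstar 0) (wK 0) δ

/-- The free associative algebra `K⟨Y ∪ Z⟩`: variable `(false, i)` is `y_i`,
variable `(true, i)` is `z_i`. -/
abbrev FA := FreeAlgebra K (Bool × ℕ)

/-- The even variables `y_i`. -/
def Yv (i : ℕ) : FA K := FreeAlgebra.ι K (false, i)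

/-- The odd variables `z_i`. -/
def Zv (i : ℕ) : FA K := FreeAlgebra.ι K (true, i)

/-- The Jordan product `a ∘ b = ab + ba`. -/
def circ {R : Type*} [Ring R] (a b : R) : R := a * b + b * a

/-- Substitution `y_i ↦ a i`, `z_i ↦ z i` as an algebra homomorphism. -/
def ev {B : Type*} [Ring B] [Algebra K B] (a z : ℕ → B) : FA K →ₐ[K] B :=
  FreeAlgebra.lift K (fun v => if v.1 then z v.2 else a v.2)

/-- `f` is a 2-graded polynomial identity of the `ℤ₂`-graded algebra `B = B₀ ⊕ B₁`. -/
def GIdent {B : Type*} [Ring B] [Algebra K B] (B0 B1 : Submodule K B) (f : FA K) : Prop :=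
  ∀ a z : ℕ → B, (∀ i, a i ∈ B0) → (∀ i, z i ∈ B1) → ev K a z f = 0

/-- `f` is an ordinary polynomial identity of `B`. -/
def OIdent (B : Type) [Ring B] [Algebra K B] (f : FA K) : Prop :=
  ∀ u : Bool × ℕ → B, FreeAlgebra.lift K u f = 0

/-- The homogeneous component of degree `δ` of the free algebra `K⟨Y ∪ Z⟩`
(span of the monomials whose number of odd variables has parity `δ`). -/
def FAdeg (δ : ZMod 2) : Submodule K (FA K) :=
  Submodule.span K { w | ∃ l : List (Bool × ℕ),
    ((l.countP (fun v => v.1) : ℕ) : ZMod 2) = δ ∧ w = (l.map (FreeAlgebra.ι K)).prod }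

/-- A grading-preserving endomorphism of the free algebra `K⟨Y ∪ Z⟩`. -/
def GradedEndo (φ : FA K →ₐ[K] FA K) : Prop :=
  (∀ i, φ (Yv K i) ∈ FAdeg K 0) ∧ (∀ i, φ (Zv K i) ∈ FAdeg K 1)

/-- A two-sided ideal of `K⟨Y ∪ Z⟩` is a `T₂`-ideal if it is invariant under all
grading-preserving endomorphisms. -/
def IsT2Ideal (J : TwoSidedIdeal (FA K)) : Prop :=
  ∀ φ : FA K →ₐ[K] FA K, GradedEndo K φ → ∀ x ∈ J, φ x ∈ J

/-- The `T₂`-ideal generated by a set `S`: the smallest two-sided ideal containing `S`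
and invariant under all grading-preserving endomorphisms. -/
def T2IdealGen (S : Set (FA K)) : TwoSidedIdeal (FA K) :=
  sInf { J | S ⊆ J ∧ IsT2Ideal K J }

/-- The generators (1)–(7) of the `T₂`-ideal `I`. -/
def gens : Set (FA K) :=
  { ⁅⁅Yv K 1, Yv K 2⁆, Yv K 3⁆, ⁅⁅Yv K 1, Yv K 2⁆, Zv K 3⁆,
    ⁅⁅Yv K 1, Zv K 2⁆, Yv K 3⁆,
    circ ⁅Yv K 1, Zv K 2⁆ (Zv K 3),
    ⁅circ (Zv K 1) (Zv K 2), Zv K 3⁆,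
    circ (Zv K 1) (Zv K 2) * circ (Zv K 3) (Zv K 4)
      - circ (Zv K 1) (Zv K 3) * circ (Zv K 2) (Zv K 4),
    ⁅Yv K 1, Yv K 2⁆ * ⁅Yv K 3, Yv K 4⁆ + ⁅Yv K 1, Yv K 3⁆ * ⁅Yv K 2, Yv K 4⁆,
    ⁅Yv K 1, Yv K 2⁆ * ⁅Yv K 3, Zv K 4⁆ + ⁅Yv K 1, Yv K 3⁆ * ⁅Yv K 2, Zv K 4⁆,
    ⁅Zv K 1, Yv K 2⁆ * ⁅Yv K 3, Yv K 4⁆ + ⁅Zv K 1, Yv K 3⁆ * ⁅Yv K 2, Yv K 4⁆,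
    ⁅Zv K 1, Yv K 2⁆ * ⁅Yv K 3, Zv K 4⁆ + ⁅Zv K 1, Yv K 3⁆ * ⁅Yv K 2, Zv K 4⁆,
    ⁅Yv K 1, Zv K 2⁆ * circ (Zv K 3) (Zv K 4) - ⁅Yv K 1, Zv K 3⁆ * circ (Zv K 2) (Zv K 4) }

/-- The product `[y_1, z_1][y_2, z_1] ⋯ [y_k, z_1]`. -/
def prodYZ (k : ℕ) : FA K := ((List.range k).map (fun i => ⁅Yv K (i + 1), Zv K 1⁆)).prod

/-- The generators (1)–(7) together with (8) and (9) of the `T₂`-ideal `I_p`. -/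
def gensP (p : ℕ) : Set (FA K) :=
  gens K ∪ { f | ∃ n k : ℕ, 1 ≤ k ∧ 2 * n + 2 * k - 1 = p ∧
    (f = prodYZ K (2 * k - 2) * circ (Zv K 2) (Zv K 1) * (Zv K 1) ^ (2 * n) ∨
     f = prodYZ K (2 * k - 1) * (Zv K 1) ^ (2 * n)) }

/-- The polynomial `h = h_y · h_{y,z} · h_z`, given by the lists of index pairs of the
commutators `[y,y]`, the commutators `[y,z]` and the Jordan products `z ∘ z`. -/
def hpoly (ly lyz lz : List (ℕ × ℕ)) : FA K :=
  (ly.map (fun p => ⁅Yv K p.1, Yv K p.2⁆)).prod *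
  (lyz.map (fun p => ⁅Yv K p.1, Zv K p.2⁆)).prod *
  (lz.map (fun p => circ (Zv K p.1) (Zv K p.2))).prod

/-- The list `i_1, …, i_{2m+n}` of indices of the even variables occurring in `h`. -/
def yIdx (ly lyz : List (ℕ × ℕ)) : List ℕ :=
  (ly.flatMap fun p => [p.1, p.2]) ++ lyz.map Prod.fst

/-- The list `j_1, …, j_{n+2p}` of indices of the odd variables occurring in `h`. -/
def zIdx (lyz lz : List (ℕ × ℕ)) : List ℕ :=
  lyz.map Prod.snd ++ (lz.flatMap fun p => [p.1, p.2])

/-- A left-normed higher commutator of variables `[x_{v}, x_{w}, x_{u_1}, …]` (length ≥ 2). -/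
def commList (v w : Bool × ℕ) (l : List (Bool × ℕ)) : FA K :=
  l.foldl (fun acc u => ⁅acc, FreeAlgebra.ι K u⁆) ⁅FreeAlgebra.ι K v, FreeAlgebra.ι K w⁆

/-- The generators of the subalgebra `B(Y,Z)` of `Y`-proper polynomials: the odd variables
and the nontrivial higher commutators of variables. -/
def ProperGens : Set (FA K) :=
  Set.range (Zv K) ∪ { c | ∃ v w l, c = commList K v w l }

end Paper

namespace Paper

section Spanning

variable {B : Type*} [Ring B]

/-- The bracket of two variables that is a Jordan product on two odd variables and a
commutator otherwise. -/
def sbr (x : Bool × ℕ → B) (u v : Bool × ℕ) : B :=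
  if u.1 && v.1 then x u * x v + x v * x u else x u * x v - x v * x u

/-- The product of the brackets of consecutive pairs of letters. -/
def hpr (x : Bool × ℕ → B) : List (Bool × ℕ) → B
  | [] => 1
  | [_] => 0
  | u :: v :: L => sbr x u v * hpr x L

/-- The product of the variables of a given parity along a list of indices. -/
def vpr (x : Bool × ℕ → B) (b : Bool) (l : List ℕ) : B := (l.map fun i => x (b, i)).prod

/-- Indices of the spanning monomials: the even variables, the even and the odd letters in
brackets, the odd variables. -/
abbrev Idx := List ℕ × List ℕ × List ℕ × List ℕ

/-- The letters occurring in brackets. -/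
def letters (m : Idx) : List (Bool × ℕ) :=
  m.2.1.map (Prod.mk false) ++ m.2.2.1.map (Prod.mk true)

/-- The monomial with a given index. -/
def nf (x : Bool × ℕ → B) (m : Idx) : B :=
  vpr x false m.1 * hpr x (letters m) * vpr x true m.2.2.2

/-- Indices of the normal forms. -/
structure Good (m : Idx) : Prop where
  sorted_y : m.1.Pairwise (· ≤ ·)
  sorted_by : m.2.1.Pairwise (· < ·)
  sorted_bz : m.2.2.1.Pairwise (· ≤ ·)
  sorted_z : m.2.2.2.Pairwise (· < ·)
  even : Even (letters m).length

/-- The consequences, up to sign, of the identities (1)–(7) that are needed for reducing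
monomials to normal form. -/
structure Rel (x : Bool × ℕ → B) : Prop where
  pass : ∀ u v w, x w * sbr x u v = sbr x u v * x w ∨ x w * sbr x u v = -(sbr x u v * x w)
  pass_even : ∀ u v i, x (false, i) * sbr x u v = sbr x u v * x (false, i)
  across : ∀ u v w t, sbr x u v * sbr x w t = sbr x u w * sbr x v t ∨
    sbr x u v * sbr x w t = -(sbr x u w * sbr x v t)

variable {x : Bool × ℕ → B}

lemma map_sbr {C F : Type*} [Ring C] [FunLike F B C] [RingHomClass F B C] (f : F)
    (u v : Bool × ℕ) : f (sbr x u v) = sbr (fun w => f (x w)) u v := by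
  unfold sbr; split <;> simp

lemma map_hpr {C F : Type*} [Ring C] [FunLike F B C] [RingHomClass F B C] (f : F) :
    ∀ L : List (Bool × ℕ), f (hpr x L) = hpr (fun w => f (x w)) L
  | [] => by simp [hpr]
  | [_] => by simp [hpr]
  | u :: v :: L => by simp [hpr, map_sbr, map_hpr f L]

lemma map_nf {C F : Type*} [Ring C] [FunLike F B C] [RingHomClass F B C] (f : F) (m : Idx) :
    f (nf x m) = nf (fun w => f (x w)) m := by
  simp [nf, map_hpr, vpr, map_list_prod, Function.comp_def]

lemma vpr_cons (b : Bool) (i : ℕ) (l : List ℕ) : vpr x b (i :: l) = x (b, i) * vpr x b l := by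
  simp [vpr]

lemma sbr_swap (u v : Bool × ℕ) : sbr x u v = sbr x v u ∨ sbr x u v = -sbr x v u := by
  unfold sbr
  rw [Bool.and_comm v.1]
  split
  · exact Or.inl (add_comm _ _)
  · exact Or.inr (neg_sub _ _).symm

lemma hpr_append_pair (u v : Bool × ℕ) :
    ∀ L : List (Bool × ℕ), hpr x (L ++ [u, v]) = hpr x L * sbr x u v
  | [] => by simp [hpr]
  | [_] => by simp [hpr]
  | a :: b :: L => by simp [hpr, hpr_append_pair u v L, mul_assoc]

lemma hpr_of_not_even : ∀ L : List (Bool × ℕ), ¬ Even L.length → hpr x L = 0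
  | [] => by simp
  | [_] => by simp [hpr]
  | u :: v :: L => fun h => by
    rw [hpr, hpr_of_not_even L, mul_zero]
    simpa [Nat.even_add_one] using h

lemma Rel.hpr_swap (hx : Rel x) (u v : Bool × ℕ) (L : List (Bool × ℕ)) :
    ∀ P : List (Bool × ℕ), hpr x (P ++ u :: v :: L) = hpr x (P ++ v :: u :: L) ∨
      hpr x (P ++ u :: v :: L) = -hpr x (P ++ v :: u :: L)
  | [] => by
    rcases sbr_swap (x := x) u v with h | h <;> simp [hpr, h]
  | [a] => by
    cases L with
    | nil => simp [hpr]
    | cons t L =>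
      rcases hx.across a u v t with h | h
      · left; simp only [List.cons_append, List.nil_append, hpr, ← mul_assoc, h]
      · right; simp only [List.cons_append, List.nil_append, hpr, ← mul_assoc, h, neg_mul]
  | a :: b :: P => by
    rcases hx.hpr_swap u v L P with h | h
    · left; simp only [List.cons_append, hpr, h]
    · right; simp only [List.cons_append, hpr, h, mul_neg]

lemma Rel.hpr_perm (hx : Rel x) {L L' : List (Bool × ℕ)} (h : L.Perm L') :
    hpr x L = hpr x L' ∨ hpr x L = -hpr x L' := by
  suffices ∀ P, hpr x (P ++ L) = hpr x (P ++ L') ∨ hpr x (P ++ L) = -hpr x (P ++ L') from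
    this []
  induction h with
  | nil => simp
  | cons u _ ih => intro P; simpa using ih (P ++ [u])
  | swap u v L => exact hx.hpr_swap v u L
  | trans _ _ ih₁ ih₂ =>
    intro P
    rcases ih₁ P with h | h <;> rcases ih₂ P with h' | h' <;> simp [h, h']

lemma Rel.hpr_of_duplicate (hx : Rel x) {i : ℕ} {L L' : List (Bool × ℕ)}
    (h : L.Perm ((false, i) :: (false, i) :: L')) : hpr x L = 0 := by
  rcases hx.hpr_perm h with h | h <;> simp [h, hpr, sbr]

lemma Rel.pass_hpr (hx : Rel x) (w : Bool × ℕ) : ∀ L : List (Bool × ℕ),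
    x w * hpr x L = hpr x L * x w ∨ x w * hpr x L = -(hpr x L * x w)
  | [] => by simp [hpr]
  | [_] => by simp [hpr]
  | u :: v :: L => by
    rcases hx.pass u v w with h | h <;> rcases hx.pass_hpr w L with h' | h' <;>
      simp [hpr, ← mul_assoc, h] <;> simp [mul_assoc, h']

variable {K : Type*} [Field K] [Algebra K B]

variable (K) in
/-- Combinations of even monomials of degree at most `k - 2` times a bracket. -/
def lowY (x : Bool × ℕ → B) (k : ℕ) : Submodule K B :=
  Submodule.span K {b | ∃ l u v, l.length + 2 ≤ k ∧ b = vpr x false l * sbr x u v}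

variable (K) in
/-- Combinations of brackets times odd monomials of degree at most `k - 2`. -/
def lowZ (x : Bool × ℕ → B) (k : ℕ) : Submodule K B :=
  Submodule.span K {b | ∃ l u v, l.length + 2 ≤ k ∧ b = sbr x u v * vpr x true l}

lemma map_mem_of_mem_span {M N : Type*} [AddCommGroup M] [Module K M] [AddCommGroup N]
    [Module K N] (f : M →ₗ[K] N) {s : Set M} {q : Submodule K N} (h : ∀ a ∈ s, f a ∈ q)
    {a : M} (ha : a ∈ Submodule.span K s) : f a ∈ q :=
  (Submodule.span_le (p := q.comap f)).2 h ha

lemma cons_mem_lowY {k i : ℕ} {b : B} (hb : b ∈ lowY K x k) :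
    x (false, i) * b ∈ lowY K x (k + 1) := by
  refine map_mem_of_mem_span (LinearMap.mulLeft K (x (false, i))) ?_ hb
  rintro _ ⟨l, u, v, hl, rfl⟩
  exact Submodule.subset_span ⟨i :: l, u, v, by simp; omega, by simp [vpr_cons, mul_assoc]⟩

lemma Rel.cons_mem_lowZ (hx : Rel x) {k i : ℕ} {b : B} (hb : b ∈ lowZ K x k) :
    x (true, i) * b ∈ lowZ K x (k + 1) := by
  refine map_mem_of_mem_span (LinearMap.mulLeft K (x (true, i))) ?_ hb
  rintro _ ⟨l, u, v, hl, rfl⟩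
  have key : sbr x u v * vpr x true (i :: l) ∈ lowZ K x (k + 1) :=
    Submodule.subset_span ⟨i :: l, u, v, by simp; omega, rfl⟩
  rw [LinearMap.mulLeft_apply, ← mul_assoc]
  rw [vpr_cons, ← mul_assoc] at key
  rcases hx.pass u v (true, i) with h | h
  · rwa [h]
  · rw [h, neg_mul]; exact neg_mem key

lemma Rel.sbr_vpr (hx : Rel x) (u v : Bool × ℕ) :
    ∀ l, sbr x u v * vpr x false l = vpr x false l * sbr x u v
  | [] => by simp [vpr]
  | i :: l => by
    rw [vpr_cons, ← mul_assoc, ← hx.pass_even, mul_assoc, hx.sbr_vpr u v l, mul_assoc]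

lemma Rel.vpr_even_perm (hx : Rel x) {l l' : List ℕ} (h : l.Perm l') :
    vpr x false l - vpr x false l' ∈ lowY K x l.length := by
  induction h with
  | nil => simp
  | cons i _ ih =>
    rw [vpr_cons, vpr_cons, ← mul_sub]
    exact cons_mem_lowY ih
  | swap i j l =>
    refine Submodule.subset_span ⟨l, (false, j), (false, i), by simp, ?_⟩
    rw [← hx.sbr_vpr]
    simp [vpr_cons, sbr, sub_mul, mul_assoc]
  | trans h _ ih₁ ih₂ =>
    rw [← h.length_eq] at ih₂
    simpa using add_mem ih₁ ih₂

lemma Rel.vpr_odd_perm (hx : Rel x) {l l' : List ℕ} (h : l.Perm l') :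
    vpr x true l - vpr x true l' ∈ lowZ K x l.length ∨
      vpr x true l + vpr x true l' ∈ lowZ K x l.length := by
  induction h with
  | nil => simp
  | cons i _ ih =>
    rw [vpr_cons, vpr_cons, ← mul_sub, ← mul_add]
    exact ih.imp hx.cons_mem_lowZ hx.cons_mem_lowZ
  | swap i j l =>
    right
    refine Submodule.subset_span ⟨l, (true, j), (true, i), by simp, ?_⟩
    simp [vpr_cons, sbr, add_mul, mul_assoc]
  | @trans l₁ l₂ l₃ h _ ih₁ ih₂ =>
    rw [← h.length_eq] at ih₂
    rcases ih₁ with h₁ | h₁ <;> rcases ih₂ with h₂ | h₂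
    · left; convert add_mem h₁ h₂ using 1; abel
    · right; convert add_mem h₁ h₂ using 1; abel
    · right; convert sub_mem h₁ h₂ using 1; abel
    · left; convert sub_mem h₁ h₂ using 1; abel

lemma Rel.odd_comm_vpr (hx : Rel x) (i : ℕ) : ∀ l : List ℕ,
    x (true, i) * vpr x false l - vpr x false l * x (true, i) ∈ lowY K x (l.length + 1)
  | [] => by simp [vpr]
  | j :: l => by
    have h₁ := cons_mem_lowY (i := j) (hx.odd_comm_vpr i l)
    have h₂ : vpr x false l * sbr x (true, i) (false, j) ∈ lowY K x (l.length + 1 + 1) :=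
      Submodule.subset_span ⟨l, _, _, le_rfl, rfl⟩
    rw [← hx.sbr_vpr] at h₂
    have h := add_mem h₁ h₂
    simp only [sbr, Bool.and_false, Bool.false_eq_true, if_false, sub_mul, mul_sub,
      mul_assoc] at h
    simpa [vpr_cons, mul_assoc] using h

variable (K) in
/-- The span of the normal forms. -/
def nfSpan (x : Bool × ℕ → B) : Submodule K B := Submodule.span K (nf x '' {m | Good m})

lemma exists_perm_of_not_nodup {l : List ℕ} (h : ¬ l.Nodup) : ∃ i l', l.Perm (i :: i :: l') := by
  obtain ⟨i, hi⟩ := List.exists_duplicate_iff_not_nodup.2 h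
  obtain ⟨l', hl'⟩ := (List.duplicate_iff_sublist.1 hi).exists_perm_append
  exact ⟨i, l', hl'⟩

lemma exists_sorted_perm (l : List ℕ) : ∃ l', l.Perm l' ∧ l'.Pairwise (· ≤ ·) :=
  ⟨_, (l.perm_insertionSort (· ≤ ·)).symm, l.pairwise_insertionSort (· ≤ ·)⟩

lemma letters_perm (L : List (Bool × ℕ)) :
    ∃ l₁ l₂ : List ℕ, l₁.Pairwise (· ≤ ·) ∧ l₂.Pairwise (· ≤ ·) ∧
      L.Perm (l₁.map (Prod.mk false) ++ l₂.map (Prod.mk true)) := by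
  suffices ∃ l₁ l₂ : List ℕ, L.Perm (l₁.map (Prod.mk false) ++ l₂.map (Prod.mk true)) by
    obtain ⟨l₁, l₂, h⟩ := this
    obtain ⟨l₁', h₁, hs₁⟩ := exists_sorted_perm l₁
    obtain ⟨l₂', h₂, hs₂⟩ := exists_sorted_perm l₂
    exact ⟨l₁', l₂', hs₁, hs₂, h.trans ((h₁.map _).append (h₂.map _))⟩
  induction L with
  | nil => exact ⟨[], [], by simp⟩
  | cons u L ih =>
    obtain ⟨l₁, l₂, h⟩ := ih
    obtain ⟨b, i⟩ := u
    cases b with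
    | false => exact ⟨i :: l₁, l₂, by simpa using h⟩
    | true => exact ⟨l₁, i :: l₂, by simpa using (h.cons _).trans List.perm_middle.symm⟩

lemma pairwise_lt {l : List ℕ} (h : l.Pairwise (· ≤ ·)) (h' : l.Nodup) : l.Pairwise (· < ·) :=
  h.imp₂ (fun _ _ => lt_of_le_of_ne) h'

lemma Rel.monomial_mem_nfSpan [CharZero K] (hx : Rel x) (n : ℕ) :
    ∀ (l₁ : List ℕ) (L : List (Bool × ℕ)) (l₂ : List ℕ), l₁.length + l₂.length = n →
      vpr x false l₁ * hpr x L * vpr x true l₂ ∈ nfSpan K x := by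
  induction n using Nat.strong_induction_on with
  | _ n IH =>
  have lowY_mem : ∀ (k : ℕ) (L : List (Bool × ℕ)) (l₂ : List ℕ), k + l₂.length = n →
      ∀ b ∈ lowY K x k, b * hpr x L * vpr x true l₂ ∈ nfSpan K x := by
    intro k L l₂ hn b hb
    rw [mul_assoc]
    refine map_mem_of_mem_span (LinearMap.mulRight K (hpr x L * vpr x true l₂)) ?_ hb
    rintro _ ⟨l, u, v, hl, rfl⟩
    simpa [hpr, mul_assoc] using IH (l.length + l₂.length) (by omega) l (u :: v :: L) l₂ rfl
  have lowZ_mem : ∀ (l₁ : List ℕ) (L : List (Bool × ℕ)) (k : ℕ), l₁.length + k = n →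
      ∀ b ∈ lowZ K x k, vpr x false l₁ * hpr x L * b ∈ nfSpan K x := by
    intro l₁ L k hn b hb
    refine map_mem_of_mem_span (LinearMap.mulLeft K (vpr x false l₁ * hpr x L)) ?_ hb
    rintro _ ⟨l, u, v, hl, rfl⟩
    simpa [hpr_append_pair, mul_assoc] using
      IH (l₁.length + l.length) (by omega) l₁ (L ++ [u, v]) l rfl
  intro l₁ L l₂ hn
  obtain ⟨l₁', hp₁, hl₁⟩ := exists_sorted_perm l₁
  have h₁ := lowY_mem l₁.length L l₂ hn _ (hx.vpr_even_perm (K := K) hp₁)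
  rw [sub_mul, sub_mul] at h₁
  refine (Submodule.sub_mem_iff_left _ ?_).1 h₁
  have hn₁ : l₁'.length + l₂.length = n := by rw [← hn, hp₁.length_eq]
  by_cases hd : l₂.Nodup
  swap
  · obtain ⟨i, l', hp⟩ := exists_perm_of_not_nodup hd
    have hlow : vpr x true (i :: i :: l') ∈ lowZ K x l₂.length := by
      rw [hp.length_eq]
      have : sbr x (true, i) (true, i) * vpr x true l' ∈ lowZ K x (i :: i :: l').length :=
        Submodule.subset_span ⟨l', _, _, by simp, rfl⟩
      convert Submodule.smul_mem _ (2⁻¹ : K) this using 1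
      simp only [sbr, vpr_cons, Bool.and_self, if_true, add_mul, mul_assoc]
      rw [← two_smul K, smul_smul, inv_mul_cancel₀ two_ne_zero, one_smul]
    refine lowZ_mem l₁' L _ hn₁ _ ?_
    rcases hx.vpr_odd_perm (K := K) hp with h | h
    · exact (Submodule.sub_mem_iff_left _ hlow).1 h
    · exact (Submodule.add_mem_iff_left _ hlow).1 h
  obtain ⟨lS, lJ, hS, hJ, hL⟩ := letters_perm L
  obtain ⟨l₂', hp₂, hl₂⟩ := exists_sorted_perm l₂
  suffices h : vpr x false l₁' * hpr x L * vpr x true l₂' ∈ nfSpan K x by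
    rcases hx.vpr_odd_perm (K := K) hp₂ with h' | h'
    · have := lowZ_mem l₁' L _ hn₁ _ h'
      rw [mul_sub] at this
      exact (Submodule.sub_mem_iff_left _ h).1 this
    · have := lowZ_mem l₁' L _ hn₁ _ h'
      rw [mul_add] at this
      exact (Submodule.add_mem_iff_left _ h).1 this
  by_cases hev : Even L.length
  swap
  · simp [hpr_of_not_even L hev]
  by_cases hdS : lS.Nodup
  swap
  · obtain ⟨i, l', hp⟩ := exists_perm_of_not_nodup hdS
    rw [hx.hpr_of_duplicate (i := i) (hL.trans ((hp.map _).append_right _))]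
    simp
  have key : nf x (l₁', lS, lJ, l₂') ∈ nfSpan K x := by
    refine Submodule.subset_span ⟨_, ⟨hl₁, pairwise_lt hS hdS, hJ,
      pairwise_lt hl₂ (hp₂.nodup_iff.1 hd), ?_⟩, rfl⟩
    simpa [letters, hL.length_eq] using hev
  rcases hx.hpr_perm hL with h | h
  · rwa [h]
  · rw [h, mul_neg, neg_mul]; exact neg_mem key

lemma Rel.lift_mem_nfSpan [CharZero K] (hx : Rel x) (f : FreeAlgebra K (Bool × ℕ)) :
    FreeAlgebra.lift K x f ∈ nfSpan K x := by
  have mono : ∀ l₁ L l₂, vpr x false l₁ * hpr x L * vpr x true l₂ ∈ nfSpan K x :=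
    fun l₁ L l₂ => hx.monomial_mem_nfSpan _ l₁ L l₂ rfl
  have step : ∀ u, ∀ b ∈ nfSpan K x, x u * b ∈ nfSpan K x := by
    intro u b hb
    refine map_mem_of_mem_span (LinearMap.mulLeft K (x u)) ?_ hb
    rintro _ ⟨m, -, rfl⟩
    obtain ⟨b, i⟩ := u
    rw [LinearMap.mulLeft_apply, nf]
    generalize letters m = L
    cases b with
    | false => simpa [vpr_cons, mul_assoc] using mono (i :: m.1) L m.2.2.2
    | true =>
      have h₁ : (x (true, i) * vpr x false m.1 - vpr x false m.1 * x (true, i)) *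
          (hpr x L * vpr x true m.2.2.2) ∈ nfSpan K x := by
        refine map_mem_of_mem_span (LinearMap.mulRight K (hpr x L * vpr x true m.2.2.2)) ?_
          (hx.odd_comm_vpr i m.1)
        rintro _ ⟨l, u, v, hl, rfl⟩
        simpa [hpr, mul_assoc] using mono l (u :: v :: L) m.2.2.2
      rw [sub_mul] at h₁
      simp only [mul_assoc] at h₁ ⊢
      refine (Submodule.sub_mem_iff_left _ ?_).1 h₁
      have h₂ := mono m.1 L (i :: m.2.2.2)
      simp only [vpr_cons, mul_assoc] at h₂
      rw [← mul_assoc (x (true, i))]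
      rcases hx.pass_hpr (true, i) L with h | h
      · rwa [h, mul_assoc]
      · rw [h, neg_mul, mul_neg, mul_assoc]; exact neg_mem h₂
  have all : ∀ f : FreeAlgebra K (Bool × ℕ), ∀ b ∈ nfSpan K x,
      FreeAlgebra.lift K x f * b ∈ nfSpan K x := by
    intro f
    induction f using FreeAlgebra.induction with
    | grade0 r => intro b hb; simpa [← Algebra.smul_def] using Submodule.smul_mem _ r hb
    | grade1 u => intro b hb; simpa using step u b hb
    | mul f g hf hg => intro b hb; rw [map_mul, mul_assoc]; exact hf _ (hg _ hb)
    | add f g hf hg => intro b hb; rw [map_add, add_mul]; exact add_mem (hf _ hb) (hg _ hb)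
  simpa using all f 1 (by simpa [vpr, hpr] using mono [] [] [])

end Spanning

section Relations

variable {B : Type*} [Ring B] (x : Bool × ℕ → B)

/-- The identities (1)–(7) for the variables, together with the consequence
`[y₁,y₂](z₁∘z₂) = [y₂,z₂][y₁,z₁]` of (3). -/
structure VarRel : Prop where
  lie_yy : ∀ i j w, ⁅⁅x (false, i), x (false, j)⁆, x w⁆ = 0
  lie_yz : ∀ i j k, ⁅⁅x (false, i), x (true, j)⁆, x (false, k)⁆ = 0
  circ_yz : ∀ i j k, ⁅x (false, i), x (true, j)⁆ * x (true, k) +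
    x (true, k) * ⁅x (false, i), x (true, j)⁆ = 0
  lie_zz : ∀ i j k, ⁅x (true, i) * x (true, j) + x (true, j) * x (true, i), x (true, k)⁆ = 0
  zz_zz : ∀ i j k l, (x (true, i) * x (true, j) + x (true, j) * x (true, i)) *
      (x (true, k) * x (true, l) + x (true, l) * x (true, k)) -
    (x (true, i) * x (true, k) + x (true, k) * x (true, i)) *
      (x (true, j) * x (true, l) + x (true, l) * x (true, j)) = 0
  xy_yx : ∀ u i j v, ⁅x u, x (false, i)⁆ * ⁅x (false, j), x v⁆ +
    ⁅x u, x (false, j)⁆ * ⁅x (false, i), x v⁆ = 0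
  yz_zz : ∀ i j k l, ⁅x (false, i), x (true, j)⁆ *
      (x (true, k) * x (true, l) + x (true, l) * x (true, k)) -
    ⁅x (false, i), x (true, k)⁆ * (x (true, j) * x (true, l) + x (true, l) * x (true, j)) = 0
  yy_zz : ∀ i j k l, ⁅x (false, i), x (false, j)⁆ *
      (x (true, k) * x (true, l) + x (true, l) * x (true, k)) -
    ⁅x (false, j), x (true, l)⁆ * ⁅x (false, i), x (true, k)⁆ = 0

variable {x}

lemma lie_anti (a b : B) : ⁅a, b⁆ = -⁅b, a⁆ := by simp [Ring.lie_def]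

lemma sbr_false_left (i : ℕ) (u : Bool × ℕ) : sbr x (false, i) u = ⁅x (false, i), x u⁆ := rfl

lemma sbr_true_false (i j : ℕ) :
    sbr x (true, i) (false, j) = -⁅x (false, j), x (true, i)⁆ := by
  simp [sbr, Ring.lie_def]

lemma sbr_true_true (i j : ℕ) :
    sbr x (true, i) (true, j) = x (true, i) * x (true, j) + x (true, j) * x (true, i) := rfl

lemma VarRel.rel (h : VarRel x) : Rel x := by
  have zzy : ∀ i j k, x (false, k) * sbr x (true, i) (true, j) =
      sbr x (true, i) (true, j) * x (false, k) := by
    intro i j k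
    have h₁ := h.circ_yz k i j
    have h₂ := h.circ_yz k j i
    rw [sbr_true_true, ← sub_eq_zero]
    calc _ = (⁅x (false, k), x (true, i)⁆ * x (true, j) + x (true, j) * ⁅x (false, k), x (true, i)⁆)
          + (⁅x (false, k), x (true, j)⁆ * x (true, i) +
            x (true, i) * ⁅x (false, k), x (true, j)⁆) := by simp only [Ring.lie_def]; noncomm_ring
      _ = 0 := by rw [h₁, h₂, add_zero]
  have even : ∀ u v i, x (false, i) * sbr x u v = sbr x u v * x (false, i) := by
    rintro ⟨_ | _, i⟩ ⟨_ | _, j⟩ k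
    · exact (sub_eq_zero.1 (h.lie_yy i j _)).symm
    · exact (sub_eq_zero.1 (h.lie_yz i j _)).symm
    · rw [sbr_true_false, mul_neg, neg_mul, neg_inj]
      exact (sub_eq_zero.1 (h.lie_yz j i _)).symm
    · exact zzy i j k
  have yy : ∀ i j w, x w * sbr x (false, i) (false, j) = sbr x (false, i) (false, j) * x w :=
    fun i j w => (sub_eq_zero.1 (h.lie_yy i j w)).symm
  have zz : ∀ i j w, x w * sbr x (true, i) (true, j) = sbr x (true, i) (true, j) * x w := by
    rintro i j ⟨_ | _, k⟩
    · exact even _ _ _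
    · exact (sub_eq_zero.1 (h.lie_zz i j k)).symm
  have yz : ∀ i j k, x (true, k) * sbr x (false, i) (true, j) =
      -(sbr x (false, i) (true, j) * x (true, k)) :=
    fun i j k => eq_neg_of_add_eq_zero_right (h.circ_yz i j k)
  -- the brackets of two variables, as atoms
  obtain ⟨Y, hY⟩ : ∃ Y : ℕ → ℕ → B, ∀ i j, Y i j = ⁅x (false, i), x (false, j)⁆ :=
    ⟨_, fun _ _ => rfl⟩
  obtain ⟨M, hM⟩ : ∃ M : ℕ → ℕ → B, ∀ i j, M i j = ⁅x (false, i), x (true, j)⁆ :=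
    ⟨_, fun _ _ => rfl⟩
  obtain ⟨Z, hZ⟩ : ∃ Z : ℕ → ℕ → B, ∀ i j,
    Z i j = x (true, i) * x (true, j) + x (true, j) * x (true, i) := ⟨_, fun _ _ => rfl⟩
  have Yanti : ∀ i j, Y i j = -Y j i := by simp [hY, Ring.lie_def]
  have Zsymm : ∀ i j, Z i j = Z j i := fun i j => by rw [hZ, hZ, add_comm]
  have YM : ∀ i j k l, M k l * Y i j = Y i j * M k l := by
    intro i j k l
    have h₁ := yy i j (false, k)
    have h₂ := yy i j (true, l)
    simp only [sbr_false_left, ← hY] at h₁ h₂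
    rw [hM, Ring.lie_def]
    exact (Commute.mul_left h₁ h₂).sub_left (Commute.mul_left h₂ h₁)
  have YZ : ∀ i j k l, Z k l * Y i j = Y i j * Z k l := by
    intro i j k l
    have h₁ := yy i j (true, k)
    have h₂ := yy i j (true, l)
    simp only [sbr_false_left, ← hY] at h₁ h₂
    rw [hZ]
    exact (Commute.mul_left h₁ h₂).add_left (Commute.mul_left h₂ h₁)
  have ZM : ∀ i j k l, M k l * Z i j = Z i j * M k l := by
    intro i j k l
    have h₁ := zz i j (false, k)
    have h₂ := zz i j (true, l)
    simp only [sbr_true_true, ← hZ] at h₁ h₂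
    rw [hM, Ring.lie_def]
    exact (Commute.mul_left h₁ h₂).sub_left (Commute.mul_left h₂ h₁)
  have MM : ∀ i j k l, M k l * M i j = -(M i j * M k l) := by
    intro i j k l
    have h₁ := even (false, i) (true, j) k
    have h₂ := yz i j l
    simp only [sbr_false_left, ← hM] at h₁ h₂
    rw [hM k l, Ring.lie_def, sub_mul, mul_sub, mul_assoc, h₂, mul_neg, ← mul_assoc, h₁,
      mul_assoc, mul_assoc, h₁, ← mul_assoc (x (true, l)), h₂, neg_mul, mul_assoc]
    abel
  have F1 : ∀ a b c d, Y a b * Y c d = -(Y a c * Y b d) := fun a b c d => by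
    simpa [hY] using eq_neg_of_add_eq_zero_left (h.xy_yx (false, a) b c (false, d))
  have F2 : ∀ a b c e, Y a b * M c e = -(Y a c * M b e) := fun a b c e => by
    simpa [hY, hM] using eq_neg_of_add_eq_zero_left (h.xy_yx (false, a) b c (true, e))
  have F3 : ∀ b c d e, M b e * Y c d = -(M c e * Y b d) := fun b c d e => by
    have := h.xy_yx (true, e) b c (false, d)
    rw [lie_anti (x (true, e)), lie_anti (x (true, e)), ← hY, ← hY, ← hM, ← hM, neg_mul, neg_mul,
      ← neg_add, neg_eq_zero] at this
    exact eq_neg_of_add_eq_zero_left this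
  have F4 : ∀ b c e f, M b e * M c f = -(M c e * M b f) := fun b c e f => by
    have := h.xy_yx (true, e) b c (true, f)
    rw [lie_anti (x (true, e)), lie_anti (x (true, e)), ← hM, ← hM, ← hM, ← hM, neg_mul, neg_mul,
      ← neg_add, neg_eq_zero] at this
    exact eq_neg_of_add_eq_zero_left this
  have F5 : ∀ a b c d, Z a b * Z c d = Z a c * Z b d := fun a b c d => by
    simpa [hZ] using sub_eq_zero.1 (h.zz_zz a b c d)
  have F7 : ∀ a e f g, M a e * Z f g = M a f * Z e g := fun a e f g => by
    simpa [hZ, hM] using sub_eq_zero.1 (h.yz_zz a e f g)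
  have F8 : ∀ a b e f, Y a b * Z e f = M b f * M a e := fun a b e f => by
    simpa [hY, hZ, hM] using sub_eq_zero.1 (h.yy_zz a b e f)
  have sY : ∀ i j, sbr x (false, i) (false, j) = Y i j := fun i j => (hY i j).symm
  have sM : ∀ i j, sbr x (false, i) (true, j) = M i j := fun i j => (hM i j).symm
  have sN : ∀ i j, sbr x (true, i) (false, j) = -M j i := fun i j => by rw [hM, sbr_true_false]
  have sZ : ∀ i j, sbr x (true, i) (true, j) = Z i j := fun i j => (hZ i j).symm
  refine ⟨?_, even, ?_⟩
  · rintro ⟨_ | _, i⟩ ⟨_ | _, j⟩ ⟨_ | _, k⟩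
    · exact .inl (even _ _ _)
    · exact .inl (yy _ _ _)
    · exact .inl (even _ _ _)
    · exact .inr (yz _ _ _)
    · exact .inl (even _ _ _)
    · right; have := yz j i k; simp only [sM, sN] at *; simp [this]
    · exact .inl (even _ _ _)
    · exact .inl (zz _ _ _)
  · have yz_step : ∀ u a e t, sbr x u (false, a) * sbr x (true, e) t =
        -(sbr x u (true, e) * sbr x (false, a) t) := by
      rintro ⟨_ | _, u⟩ a e ⟨_ | _, t⟩ <;> simp only [sY, sM, sN, sZ]
      · rw [mul_neg, neg_inj, YM, F2 a, Yanti a, neg_mul, neg_neg]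
      · rw [F8, MM]
      · rw [neg_mul_neg, YZ, F8, MM]
      · rw [neg_mul, neg_inj, ← ZM, Zsymm e t, F7, Zsymm u e, Zsymm]
    rintro ⟨_ | _, i⟩ ⟨_ | _, j⟩ ⟨_ | _, k⟩ ⟨_ | _, l⟩
    · right; simp only [sY]; rw [F1]
    · right; simp only [sY, sM]; rw [F2]
    · exact .inr (yz_step _ _ _ _)
    · exact .inr (yz_step _ _ _ _)
    · exact .inr (by rw [yz_step, neg_neg])
    · exact .inr (by rw [yz_step, neg_neg])
    · left; simp only [sM, sN]; rw [mul_neg, mul_neg, MM, F4, neg_neg]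
    · left; simp only [sM, sZ]; rw [F7]
    · right; simp only [sY, sN]; rw [neg_mul, neg_mul, F3]
    · right; simp only [sM, sN]; rw [neg_mul, neg_mul, F4]
    · exact .inr (yz_step _ _ _ _)
    · exact .inr (yz_step _ _ _ _)
    · exact .inr (by rw [yz_step, neg_neg])
    · exact .inr (by rw [yz_step, neg_neg])
    · left; simp only [sN, sZ]; rw [mul_neg, mul_neg, ← ZM, ← ZM, Zsymm, F7, Zsymm]
    · left; simp only [sZ]; rw [F5]
end Relations

section Quotient

variable {K : Type} [Field K]

lemma Yv_mem (i : ℕ) : Yv K i ∈ FAdeg K 0 :=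
  Submodule.subset_span ⟨[(false, i)], by simp, by simp [Yv]⟩

lemma Zv_mem (i : ℕ) : Zv K i ∈ FAdeg K 1 :=
  Submodule.subset_span ⟨[(true, i)], by simp, by simp [Zv]⟩

lemma Yv_mul_Zv_mem (i j : ℕ) : Yv K i * Zv K j ∈ FAdeg K 1 :=
  Submodule.subset_span ⟨[(false, i), (true, j)], by simp, by simp [Yv, Zv]⟩

lemma ev_Yv {B : Type*} [Ring B] [Algebra K B] (a z : ℕ → B) (i : ℕ) :
    ev K a z (Yv K i) = a i := by simp [ev, Yv]

lemma ev_Zv {B : Type*} [Ring B] [Algebra K B] (a z : ℕ → B) (i : ℕ) :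
    ev K a z (Zv K i) = z i := by simp [ev, Zv]

lemma map_circ {B C F : Type*} [Ring B] [Ring C] [FunLike F B C] [RingHomClass F B C] (f : F)
    (a b : B) : f (circ a b) = circ (f a) (f b) := by simp [circ]

lemma map_bracket {B C F : Type*} [Ring B] [Ring C] [FunLike F B C] [RingHomClass F B C] (f : F)
    (a b : B) : f ⁅a, b⁆ = ⁅f a, f b⁆ := by simp [Ring.lie_def]

lemma bracket_mul_circ {B : Type*} [Ring B] {y y' z z' : B}
    (h₁ : ⁅y, y' * z⁆ * z' + z' * ⁅y, y' * z⁆ = 0) (h₂ : ⁅y, z⁆ * z' + z' * ⁅y, z⁆ = 0)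
    (h₃ : ⁅⁅y, y'⁆, z'⁆ = 0) : ⁅y, y'⁆ * (z * z' + z' * z) - ⁅y', z'⁆ * ⁅y, z⁆ = 0 := by
  calc _ = (⁅y, y' * z⁆ * z' + z' * ⁅y, y' * z⁆) - y' * (⁅y, z⁆ * z' + z' * ⁅y, z⁆) +
        ⁅⁅y, y'⁆, z'⁆ * z := by simp only [Ring.lie_def]; noncomm_ring
    _ = 0 := by rw [h₁, h₂, h₃, mul_zero, zero_mul, sub_zero, add_zero]

/-- The variables modulo a `T₂`-ideal containing (1)–(7) satisfy the relations. -/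
lemma varRel_of_gens_subset {J : TwoSidedIdeal (FA K)} (hJ : (gens K : Set (FA K)) ⊆ J)
    (hT : IsT2Ideal K J) :
    VarRel fun u : Bool × ℕ => J.ringCon.mk' (FreeAlgebra.ι K u) := by
  have key : ∀ g ∈ gens K, ∀ a z : ℕ → FA K, (∀ i, a i ∈ FAdeg K 0) → (∀ i, z i ∈ FAdeg K 1) →
      J.ringCon.mk' (ev K a z g) = 0 := by
    intro g hg a z ha hz
    have : ev K a z g ∈ J := hT _ ⟨fun i => by rw [ev_Yv]; exact ha i,
      fun i => by rw [ev_Zv]; exact hz i⟩ g (hJ hg)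
    rw [TwoSidedIdeal.mem_iff, ← RingCon.eq] at this
    exact this
  have var : ∀ g ∈ gens K, ∀ l l' : List ℕ, J.ringCon.mk'
      (ev K (fun n => Yv K (l.getD n 0)) (fun n => Zv K (l'.getD n 0)) g) = 0 :=
    fun g hg l l' => key g hg _ _ (fun _ => Yv_mem _) (fun _ => Zv_mem _)
  have g1 := var _ (show ⁅⁅Yv K 1, Yv K 2⁆, Yv K 3⁆ ∈ gens K by simp [gens])
  have g2 := var _ (show ⁅⁅Yv K 1, Yv K 2⁆, Zv K 3⁆ ∈ gens K by simp [gens])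
  have g3 := var _ (show ⁅⁅Yv K 1, Zv K 2⁆, Yv K 3⁆ ∈ gens K by simp [gens])
  have g4 := var _ (show circ ⁅Yv K 1, Zv K 2⁆ (Zv K 3) ∈ gens K by simp [gens])
  have g5 := var _ (show ⁅circ (Zv K 1) (Zv K 2), Zv K 3⁆ ∈ gens K by simp [gens])
  have g6 := var _ (show circ (Zv K 1) (Zv K 2) * circ (Zv K 3) (Zv K 4)
      - circ (Zv K 1) (Zv K 3) * circ (Zv K 2) (Zv K 4) ∈ gens K by simp [gens])
  have g7 := var _ (show ⁅Yv K 1, Yv K 2⁆ * ⁅Yv K 3, Yv K 4⁆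
      + ⁅Yv K 1, Yv K 3⁆ * ⁅Yv K 2, Yv K 4⁆ ∈ gens K by simp [gens])
  have g8 := var _ (show ⁅Yv K 1, Yv K 2⁆ * ⁅Yv K 3, Zv K 4⁆
      + ⁅Yv K 1, Yv K 3⁆ * ⁅Yv K 2, Zv K 4⁆ ∈ gens K by simp [gens])
  have g9 := var _ (show ⁅Zv K 1, Yv K 2⁆ * ⁅Yv K 3, Yv K 4⁆
      + ⁅Zv K 1, Yv K 3⁆ * ⁅Yv K 2, Yv K 4⁆ ∈ gens K by simp [gens])
  have g10 := var _ (show ⁅Zv K 1, Yv K 2⁆ * ⁅Yv K 3, Zv K 4⁆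
      + ⁅Zv K 1, Yv K 3⁆ * ⁅Yv K 2, Zv K 4⁆ ∈ gens K by simp [gens])
  have g11 := var _ (show ⁅Yv K 1, Zv K 2⁆ * circ (Zv K 3) (Zv K 4)
      - ⁅Yv K 1, Zv K 3⁆ * circ (Zv K 2) (Zv K 4) ∈ gens K by simp [gens])
  simp only [map_add, map_sub, map_mul, map_bracket, map_circ, ev_Yv, ev_Zv]
    at g1 g2 g3 g4 g5 g6 g7 g8 g9 g10 g11
  refine ⟨?_, ?_, ?_, ?_, ?_, ?_, ?_, ?_⟩
  · rintro i j ⟨_ | _, k⟩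
    · exact g1 [0, i, j, k] []
    · exact g2 [0, i, j] [0, 0, 0, k]
  · exact fun i j k => g3 [0, i, 0, k] [0, 0, j]
  · exact fun i j k => g4 [0, i] [0, 0, j, k]
  · exact fun i j k => g5 [] [0, i, j, k]
  · exact fun i j k l => g6 [] [0, i, j, k, l]
  · rintro ⟨_ | _, i⟩ j k ⟨_ | _, l⟩
    · exact g7 [0, i, j, k, l] []
    · exact g8 [0, i, j, k] [0, 0, 0, 0, l]
    · exact g9 [0, 0, j, k, l] [0, i]
    · exact g10 [0, 0, j, k] [0, i, 0, 0, l]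
  · exact fun i j k l => g11 [0, i] [0, 0, j, k, l]
  · intro i j k l
    have h₁ := key _ (show circ ⁅Yv K 1, Zv K 2⁆ (Zv K 3) ∈ gens K by simp [gens])
      (fun _ => Yv K i) (fun n => if n = 2 then Yv K j * Zv K k else Zv K l)
      (fun _ => Yv_mem _) (fun n => by split <;> simp [Zv_mem, Yv_mul_Zv_mem])
    have h₂ := g4 [0, i] [0, 0, k, l]
    have h₃ := g2 [0, i, j] [0, 0, 0, l]
    simp only [map_bracket, map_circ, ev_Yv, ev_Zv, if_true, map_mul] at h₁
    rw [if_neg (by norm_num)] at h₁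
    simp only [Yv, Zv, circ, List.getD_cons_succ, List.getD_cons_zero] at h₁ h₂ h₃
    exact bracket_mul_circ h₁ h₂ h₃

end Quotient

section Split

variable {B : Type*} [Ring B] {p w : Bool × ℕ → B}

/-- Commutation rules for the components of homogeneous elements `p u + w u` of a ring graded
like `E ⊗ E`: the components of even elements have degrees `(0,0)` and `(1,0)`, those of odd
elements have degrees `(0,1)` and `(1,1)`. -/
structure Split (p w : Bool × ℕ → B) : Prop where
  central_p : ∀ i v, Commute (p (false, i)) (p v)
  central_w : ∀ i v, Commute (p (false, i)) (w v)
  anti_w : ∀ i v, SemiconjBy (w (false, i)) (w v) (-w v)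
  comm_wp : ∀ i j, Commute (w (false, i)) (p (true, j))
  anti_pp : ∀ i j, SemiconjBy (p (true, i)) (p (true, j)) (-p (true, j))
  anti_wp : ∀ i j, SemiconjBy (w (true, i)) (p (true, j)) (-p (true, j))
  comm_ww : ∀ i j, Commute (w (true, i)) (w (true, j))

lemma semiconjBy_two_mul {a b c : B} (h : SemiconjBy a b c) : SemiconjBy (2 * a) b c :=
  SemiconjBy.mul_left (Commute.ofNat_left 2 c) h

namespace Split

lemma comm_false_p (h : Split p w) (i : ℕ) : ∀ v, Commute (w (false, i)) (p v)
  | (false, j) => (h.central_w j _).symm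
  | (true, j) => h.comm_wp i j

lemma sbr (h : Split p w) (u v : Bool × ℕ) : sbr (p + w) u v = 2 * (w u * w v) := by
  obtain ⟨_ | _, i⟩ := u <;> obtain ⟨_ | _, j⟩ := v <;>
    simp only [Paper.sbr, Bool.and_self, Bool.and_true, Bool.and_false, if_true,
      Bool.false_eq_true, if_false, Pi.add_apply, mul_add, add_mul]
  · rw [(h.central_p i (false, j)).eq, (h.central_w i (false, j)).eq,
      (h.comm_false_p i (false, j)).eq, (h.anti_w j (false, i)).eq]
    noncomm_ring
  · rw [(h.central_p i (true, j)).eq, (h.central_w i (true, j)).eq,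
      (h.comm_false_p i (true, j)).eq, (h.anti_w i (true, j)).eq]
    noncomm_ring
  · rw [← (h.central_p j (true, i)).eq, ← (h.central_w j (true, i)).eq,
      ← (h.comm_false_p j (true, i)).eq, (h.anti_w j (true, i)).eq]
    noncomm_ring
  · rw [(h.anti_pp i j).eq, (h.anti_wp i j).eq, (h.anti_wp j i).eq, (h.comm_ww i j).eq]
    noncomm_ring

lemma lie_false (h : Split p w) (i : ℕ) (v : Bool × ℕ) :
    ⁅(p + w) (false, i), (p + w) v⁆ = 2 * (w (false, i) * w v) := h.sbr (false, i) v

lemma lie_true (h : Split p w) (i j : ℕ) :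
    ⁅(p + w) (true, i), (p + w) (false, j)⁆ = 2 * (w (true, i) * w (false, j)) :=
  h.sbr (true, i) (false, j)

lemma circ_true (h : Split p w) (i j : ℕ) :
    circ ((p + w) (true, i)) ((p + w) (true, j)) = 2 * (w (true, i) * w (true, j)) :=
  h.sbr (true, i) (true, j)

lemma lie_lie (h : Split p w) (i j : ℕ) (v : Bool × ℕ) :
    ⁅⁅(p + w) (false, i), (p + w) (false, j)⁆, (p + w) v⁆ = 0 := by
  rw [h.lie_false, Ring.lie_def, sub_eq_zero]
  refine semiconjBy_two_mul ?_
  refine Commute.add_right ((h.comm_false_p i v).mul_left (h.comm_false_p j v)) ?_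
  simpa [Commute] using (h.anti_w i v).neg_right.mul_left (h.anti_w j v)

lemma lie_lie_odd (h : Split p w) (i j k : ℕ) :
    ⁅⁅(p + w) (false, i), (p + w) (true, j)⁆, (p + w) (false, k)⁆ = 0 := by
  rw [h.lie_false, Ring.lie_def, sub_eq_zero]
  refine semiconjBy_two_mul ?_
  refine Commute.add_right ((h.central_w k _).symm.mul_left (h.central_w k _).symm) ?_
  refine Commute.symm ?_
  simpa [Commute] using (h.anti_w k (false, i)).mul_right (h.anti_w k (true, j))

lemma circ_lie (h : Split p w) (i j k : ℕ) :
    circ ⁅(p + w) (false, i), (p + w) (true, j)⁆ ((p + w) (true, k)) = 0 := by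
  rw [h.lie_false, circ]
  refine eq_neg_iff_add_eq_zero.1 ?_
  rw [← neg_mul]
  refine semiconjBy_two_mul ?_
  rw [Pi.add_apply, neg_add]
  refine SemiconjBy.add_right ?_ ?_
  · exact SemiconjBy.mul_left (h.comm_wp i k).neg_right (h.anti_wp j k)
  · exact (h.anti_w i (true, k)).mul_left (h.comm_ww j k)

lemma lie_circ (h : Split p w) (i j k : ℕ) :
    ⁅circ ((p + w) (true, i)) ((p + w) (true, j)), (p + w) (true, k)⁆ = 0 := by
  rw [h.circ_true, Ring.lie_def, sub_eq_zero]
  refine semiconjBy_two_mul ?_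
  refine Commute.add_right ?_ ((h.comm_ww i k).mul_left (h.comm_ww j k))
  simpa [Commute] using (h.anti_wp i k).neg_right.mul_left (h.anti_wp j k)

lemma gens_eq_zero {K : Type} [Field K] [Algebra K B] (h : Split p w) {f : FA K}
    (hf : f ∈ gens K) : FreeAlgebra.lift K (p + w) f = 0 := by
  have hY : ∀ i, FreeAlgebra.lift K (p + w) (Yv K i) = (p + w) (false, i) := fun i => by
    rw [Yv, FreeAlgebra.lift_ι_apply]
  have hZ : ∀ i, FreeAlgebra.lift K (p + w) (Zv K i) = (p + w) (true, i) := fun i => by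
    rw [Zv, FreeAlgebra.lift_ι_apply]
  have two : ∀ a b c d : B, 2 * (a * b) * (2 * (c * d)) = 4 * (a * (b * c) * d) := by
    intros; noncomm_ring
  have anti : ∀ i j, w (false, i) * w (false, j) = -(w (false, j) * w (false, i)) :=
    fun i j => by rw [(h.anti_w i (false, j)).eq, neg_mul]
  have comm : ∀ i j, w (true, i) * w (true, j) = w (true, j) * w (true, i) :=
    fun i j => (h.comm_ww i j).eq
  simp only [gens, Set.mem_insert_iff, Set.mem_singleton_iff] at hf
  rcases hf with rfl | rfl | rfl | rfl | rfl | rfl | rfl | rfl | rfl | rfl | rfl <;>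
    simp only [map_add, map_sub, map_mul, map_bracket, map_circ, hY, hZ]
  · exact h.lie_lie _ _ _
  · exact h.lie_lie _ _ _
  · exact h.lie_lie_odd _ _ _
  · exact h.circ_lie _ _ _
  · exact h.lie_circ _ _ _
  · rw [h.circ_true, h.circ_true, h.circ_true, h.circ_true, two, two, comm 2 3, sub_self]
  · rw [h.lie_false, h.lie_false, h.lie_false, h.lie_false, two, two, anti 2 3]
    noncomm_ring
  · rw [h.lie_false, h.lie_false, h.lie_false, h.lie_false, two, two, anti 2 3]
    noncomm_ring
  · rw [h.lie_true, h.lie_false, h.lie_true, h.lie_false, two, two, anti 2 3]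
    noncomm_ring
  · rw [h.lie_true, h.lie_false, h.lie_true, h.lie_false, two, two, anti 2 3]
    noncomm_ring
  · rw [h.lie_false, h.circ_true, h.lie_false, h.circ_true, two, two, comm 2 3, sub_self]

end Split

end Split

section Grassmann

variable (K : Type) [Field K]

/-- The product of the generators of `E` along a list. -/
def eProd (l : List ℕ) : E K := (l.map (eGen K)).prod

/-- The element `e_{i_1} ⋯ e_{i_k} ⊗ e_{j_1} ⋯ e_{j_l}` of `E ⊗ E`. -/
def tProd (q : List ℕ × List ℕ) : A K := eProd K q.1 ⊗ₜ[K] eProd K q.2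

/-- The span of the products with given numbers of factors modulo 2. -/
def biComp (g : ZMod 2 × ZMod 2) : Submodule K (A K) :=
  Submodule.span K (tProd K '' {q | ((q.1.length : ZMod 2), (q.2.length : ZMod 2)) = g})

/-- The span of the products with a given number of factors modulo 2 on the right. -/
def oneComp (δ : ZMod 2) : Submodule K (A K) :=
  Submodule.span K (tProd K '' {q | (q.2.length : ZMod 2) = δ})

variable {K}

lemma eGen_mul_eGen (i j : ℕ) : eGen K i * eGen K j = -(eGen K j * eGen K i) :=
  eq_neg_of_add_eq_zero_left (ExteriorAlgebra.ι_add_mul_swap _ _)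

lemma eProd_append (l l' : List ℕ) : eProd K (l ++ l') = eProd K l * eProd K l' := by
  simp [eProd]

lemma eGen_mul_eProd (i : ℕ) : ∀ l : List ℕ,
    eGen K i * eProd K l = (-1) ^ l.length * (eProd K l * eGen K i)
  | [] => by simp [eProd]
  | j :: l => by
    have ih := eGen_mul_eProd i l
    have h : eProd K (j :: l) = eGen K j * eProd K l := by simp [eProd]
    have hc : Commute (eGen K j) ((-1) ^ l.length) := (Commute.neg_one_right _).pow_right _
    rw [h, ← mul_assoc, eGen_mul_eGen, neg_mul, mul_assoc, ih, List.length_cons, pow_succ,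
      ← mul_assoc, hc.eq]
    noncomm_ring

lemma eProd_mul_eProd (l' : List ℕ) : ∀ l : List ℕ,
    eProd K l * eProd K l' = (-1) ^ (l.length * l'.length) * (eProd K l' * eProd K l)
  | [] => by simp [eProd]
  | j :: l => by
    have ih := eProd_mul_eProd l' l
    have h : eProd K (j :: l) = eGen K j * eProd K l := by simp [eProd]
    have hc : Commute (eGen K j) ((-1) ^ (l.length * l'.length)) :=
      (Commute.neg_one_right _).pow_right _
    rw [h, mul_assoc, ih, ← mul_assoc, hc.eq, mul_assoc, ← mul_assoc (eGen K j), eGen_mul_eProd,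
      List.length_cons, add_mul, one_mul, pow_add]
    simp only [mul_assoc]

lemma tProd_mul_tProd (q q' : List ℕ × List ℕ) :
    tProd K q * tProd K q' = tProd K (q.1 ++ q'.1, q.2 ++ q'.2) := by
  simp [tProd, eProd_append]

lemma neg_one_pow_smul_eq {M : Type*} [Ring M] [Algebra K M] (n : ℕ) (x : M) :
    (-1) ^ n * x = ((-1 : K) ^ n) • x := by
  rw [Algebra.smul_def, map_pow, map_neg, map_one]

lemma tProd_comm (q q' : List ℕ × List ℕ) : tProd K q * tProd K q' =
    ((-1 : K) ^ (q.1.length * q'.1.length + q.2.length * q'.2.length)) •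
      (tProd K q' * tProd K q) := by
  simp only [tProd, Algebra.TensorProduct.tmul_mul_tmul]
  rw [eProd_mul_eProd q'.1 q.1, eProd_mul_eProd q'.2 q.2, neg_one_pow_smul_eq (K := K),
    neg_one_pow_smul_eq (K := K), TensorProduct.smul_tmul_smul, pow_add]

lemma mul_mem_span {M : Type*} [Ring M] [Algebra K M] {s t : Set M} {N : Submodule K M}
    (h : ∀ a ∈ s, ∀ b ∈ t, a * b ∈ N) {a b : M} (ha : a ∈ Submodule.span K s)
    (hb : b ∈ Submodule.span K t) : a * b ∈ N := by
  have := Submodule.mul_mem_mul ha hb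
  rw [Submodule.span_mul_span] at this
  refine Submodule.span_le.2 ?_ this
  rintro _ ⟨a, ha, b, hb, rfl⟩
  exact h a ha b hb

lemma mul_mem_oneComp {δ ε : ZMod 2} {a b : A K} (ha : a ∈ oneComp K δ) (hb : b ∈ oneComp K ε) :
    a * b ∈ oneComp K (δ + ε) := by
  refine mul_mem_span ?_ ha hb
  rintro _ ⟨q, hq, rfl⟩ _ ⟨q', hq', rfl⟩
  rw [tProd_mul_tProd]
  refine Submodule.subset_span ⟨_, ?_, rfl⟩
  simp only [Set.mem_ofPred_eq] at *
  simp [hq, hq']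

lemma one_mem_oneComp : (1 : A K) ∈ oneComp K 0 :=
  Submodule.subset_span ⟨([], []), by simp, by simp [tProd, eProd, Algebra.TensorProduct.one_def]⟩

lemma mul_eq_smul_of_span {M : Type*} [Ring M] [Algebra K M] {s t : Set M} (c : K)
    (h : ∀ a ∈ s, ∀ b ∈ t, a * b = c • (b * a)) {a b : M} (ha : a ∈ Submodule.span K s)
    (hb : b ∈ Submodule.span K t) : a * b = c • (b * a) := by
  induction ha, hb using Submodule.span_induction₂ with
  | mem_mem a b ha hb => exact h a ha b hb
  | zero_left => simp
  | zero_right => simp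
  | add_left x y z _ _ _ hx hy => rw [add_mul, mul_add, hx, hy, smul_add]
  | add_right x y z _ _ _ hx hy => rw [add_mul, mul_add, hx, hy, smul_add]
  | smul_left r x y _ _ hx => rw [smul_mul_assoc, hx, mul_smul_comm, smul_comm]
  | smul_right r x y _ _ hx => rw [mul_smul_comm, hx, smul_mul_assoc, smul_comm]

lemma commute_of_mem {g g' : ZMod 2 × ZMod 2} (h : g.1 * g'.1 + g.2 * g'.2 = 0) {a b : A K}
    (ha : a ∈ biComp K g) (hb : b ∈ biComp K g') : Commute a b := by
  have := mul_eq_smul_of_span 1 ?_ ha hb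
  · simpa [Commute, SemiconjBy] using this
  rintro _ ⟨q, rfl, rfl⟩ _ ⟨q', rfl, rfl⟩
  rw [tProd_comm, Even.neg_one_pow]
  rw [even_iff_two_dvd, ← CharP.cast_eq_zero_iff (ZMod 2) 2]
  simpa using h

lemma anticommute_of_mem {g g' : ZMod 2 × ZMod 2} (h : g.1 * g'.1 + g.2 * g'.2 = 1) {a b : A K}
    (ha : a ∈ biComp K g) (hb : b ∈ biComp K g') : SemiconjBy a b (-b) := by
  have := mul_eq_smul_of_span (-1) ?_ ha hb
  · simpa [SemiconjBy] using this
  rintro _ ⟨q, rfl, rfl⟩ _ ⟨q', rfl, rfl⟩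
  rw [tProd_comm, Odd.neg_one_pow]
  rw [← ZMod.natCast_eq_one_iff_odd]
  simpa using h

/-- Elements of the right degrees satisfy the commutation rules. -/
lemma split_of_mem {p w : Bool × ℕ → A K}
    (hp : ∀ b i, p (b, i) ∈ biComp K (0, if b then 1 else 0))
    (hw : ∀ b i, w (b, i) ∈ biComp K (1, if b then 1 else 0)) : Split p w where
  central_p i v := commute_of_mem (by simp) (hp false i) (hp v.1 v.2)
  central_w i v := commute_of_mem (by simp) (hp false i) (hw v.1 v.2)
  anti_w i v := anticommute_of_mem (by simp) (hw false i) (hw v.1 v.2)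
  comm_wp i j := commute_of_mem (by simp) (hw false i) (hp true j)
  anti_pp i j := anticommute_of_mem (by simp) (hp true i) (hp true j)
  anti_wp i j := anticommute_of_mem (by simp) (hw true i) (hp true j)
  comm_ww i j := commute_of_mem (by decide) (hw true i) (hw true j)

lemma bEE_eq (q : Finset ℕ × Finset ℕ) : bEE K q = tProd K (q.1.sort, q.2.sort) := rfl

lemma A0star_le (δ : ZMod 2) : A0star K δ ≤ oneComp K δ := by
  refine Submodule.span_le.2 ?_
  rintro _ ⟨q, rfl, rfl⟩
  exact Submodule.subset_span ⟨_, by simp [wdeg, wKstar, wK], (bEE_eq q).symm⟩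

lemma exists_split {δ : ZMod 2} {a : A K} (ha : a ∈ oneComp K δ) :
    ∃ p ∈ biComp K (0, δ), ∃ w ∈ biComp K (1, δ), p + w = a := by
  rw [← Submodule.mem_sup]
  refine Submodule.span_le.2 ?_ ha
  rintro _ ⟨q, rfl, rfl⟩
  have : (q.1.length : ZMod 2) = 0 ∨ (q.1.length : ZMod 2) = 1 := by
    generalize (q.1.length : ZMod 2) = x
    revert x; decide
  rcases this with h | h
  · exact Submodule.mem_sup_left (Submodule.subset_span ⟨q, by simp [h], rfl⟩)
  · exact Submodule.mem_sup_right (Submodule.subset_span ⟨q, by simp [h], rfl⟩)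

/-- The polynomials (1)–(7) vanish on homogeneous elements. -/
lemma ev_gens_eq_zero {f : FA K} (hf : f ∈ gens K) {a z : ℕ → A K} (ha : ∀ i, a i ∈ oneComp K 0)
    (hz : ∀ i, z i ∈ oneComp K 1) : ev K a z f = 0 := by
  have : ∀ u : Bool × ℕ, ∃ p ∈ biComp K (0, if u.1 then 1 else 0),
      ∃ w ∈ biComp K (1, if u.1 then 1 else 0), p + w = if u.1 then z u.2 else a u.2 := by
    rintro ⟨_ | _, i⟩
    · exact exists_split (ha i)
    · exact exists_split (hz i)
  choose p hp w hw h using this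
  have := (split_of_mem (p := p) (w := w) (fun b i => hp (b, i)) fun b i =>
    hw (b, i)).gens_eq_zero hf
  rwa [show p + w = _ from funext h] at this

lemma ev_mem_oneComp {f : FA K} {δ : ZMod 2} (hf : f ∈ FAdeg K δ) {a z : ℕ → A K}
    (ha : ∀ i, a i ∈ oneComp K 0) (hz : ∀ i, z i ∈ oneComp K 1) :
    ev K a z f ∈ oneComp K δ := by
  have key : ∀ l : List (Bool × ℕ), ev K a z (l.map (FreeAlgebra.ι K)).prod ∈
      oneComp K ((l.countP fun v => v.1 : ℕ) : ZMod 2) := by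
    intro l
    induction l with
    | nil => simpa using one_mem_oneComp
    | cons u l ih =>
      rw [List.map_cons, List.prod_cons, map_mul, List.countP_cons, add_comm, Nat.cast_add]
      refine mul_mem_oneComp ?_ ih
      rcases u with ⟨_ | _, i⟩
      · simpa [ev] using ha i
      · simpa [ev] using hz i
  have hle : FAdeg K δ ≤ (oneComp K δ).comap (ev K a z).toLinearMap := by
    refine Submodule.span_le.2 ?_
    rintro _ ⟨l, rfl, rfl⟩
    exact key l
  exact hle hf

lemma ev_eq_zero_of_mem {f : FA K} (hf : f ∈ T2IdealGen K (gens K)) {a z : ℕ → A K}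
    (ha : ∀ i, a i ∈ oneComp K 0) (hz : ∀ i, z i ∈ oneComp K 1) : ev K a z f = 0 := by
  let J : TwoSidedIdeal (FA K) := .mk' {f | ∀ a z : ℕ → A K, (∀ i, a i ∈ oneComp K 0) →
      (∀ i, z i ∈ oneComp K 1) → ev K a z f = 0}
    (fun _ _ _ _ => map_zero _)
    (fun h h' a z ha hz => by rw [map_add, h a z ha hz, h' a z ha hz, add_zero])
    (fun h a z ha hz => by rw [map_neg, h a z ha hz, neg_zero])
    (fun h a z ha hz => by rw [map_mul, h a z ha hz, mul_zero])
    (fun h a z ha hz => by rw [map_mul, h a z ha hz, zero_mul])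
  have hJ : ∀ f, f ∈ J ↔ ∀ a z : ℕ → A K, (∀ i, a i ∈ oneComp K 0) →
      (∀ i, z i ∈ oneComp K 1) → ev K a z f = 0 := fun f => TwoSidedIdeal.mem_mk' ..
  refine (hJ f).1 ((TwoSidedIdeal.mem_sInf _).1 hf J ⟨?_, ?_⟩) a z ha hz
  · exact fun g hg => (hJ g).2 fun a z ha hz => ev_gens_eq_zero hg ha hz
  · intro φ hφ g hg
    rw [hJ] at hg ⊢
    intro a z ha hz
    have : (ev K a z).comp φ = ev K (fun i => ev K a z (φ (Yv K i)))
        (fun i => ev K a z (φ (Zv K i))) := by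
      refine FreeAlgebra.hom_ext (funext ?_)
      rintro ⟨_ | _, i⟩ <;> simp [ev, Yv, Zv]
    rw [← AlgHom.comp_apply, this]
    exact hg _ _ (fun i => ev_mem_oneComp (hφ.1 i) ha hz) fun i => ev_mem_oneComp (hφ.2 i) ha hz

end Grassmann

section Nonvanishing

variable {K : Type} [Field K]

lemma exists_functional_eProd {l : List ℕ} (hl : l.Nodup) :
    ∃ φ : E K →ₗ[K] K, φ (eProd K l) = 1 := by
  let g : (ℕ →₀ K) [⋀^Fin l.length]→ₗ[K] K :=
    Matrix.detRowAlternating.compLinearMap (LinearMap.pi fun j => Finsupp.lapply (l.get j))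
  refine ⟨ExteriorAlgebra.liftAlternating (Pi.single l.length g), ?_⟩
  have h : eProd K l = ExteriorAlgebra.ιMulti K l.length
      fun i => Finsupp.single (l.get i) (1 : K) := by
    rw [ExteriorAlgebra.ιMulti_apply, eProd]
    conv_lhs => rw [← List.ofFn_get l, List.map_ofFn]
    rfl
  rw [h, ExteriorAlgebra.liftAlternating_apply_ιMulti, Pi.single_eq_same]
  have h1 : (fun i => (LinearMap.pi fun j => Finsupp.lapply (l.get j) : (ℕ →₀ K) →ₗ[K] _)
      (Finsupp.single (l.get i) (1 : K))) = (1 : Matrix (Fin l.length) (Fin l.length) K) := by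
    ext i j
    simp only [LinearMap.pi_apply, Finsupp.lapply_apply, Finsupp.single_apply, Matrix.one_apply,
      hl.get_inj_iff]
  rw [AlternatingMap.compLinearMap_apply]
  erw [h1]
  exact Matrix.det_one

lemma tProd_ne_zero {l l' : List ℕ} (hl : l.Nodup) (hl' : l'.Nodup) : tProd K (l, l') ≠ 0 := by
  obtain ⟨φ, hφ⟩ := exists_functional_eProd (K := K) hl
  obtain ⟨ψ, hψ⟩ := exists_functional_eProd (K := K) hl'
  intro h
  have := congrArg (LinearMap.mul' K K ∘ₗ TensorProduct.map φ ψ) h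
  simp [tProd, hφ, hψ] at this

lemma add_pow_succ_of_sq {B : Type*} [Ring B] {s u : B} (h : Commute s u) (hu : u * u = 0)
    (m : ℕ) : (s + u) ^ (m + 1) = s ^ (m + 1) + ((m + 1 : ℕ) : B) * (s ^ m * u) := by
  induction m with
  | zero => simp
  | succ m ih =>
    rw [pow_succ, ih, add_mul, mul_add, mul_add, ← pow_succ, mul_assoc _ _ u, mul_assoc _ u u, hu,
      mul_assoc _ _ s, mul_assoc _ u s, ← h.eq, ← mul_assoc _ s u, ← pow_succ]
    push_cast
    noncomm_ring

lemma sum_range_pow {B : Type*} [Ring B] {u : ℕ → B} (h : ∀ i j, Commute (u i) (u j))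
    (hu : ∀ i, u i * u i = 0) (n : ℕ) :
    (∑ k ∈ Finset.range n, u k) ^ n = (n.factorial : B) * ((List.range n).map u).prod ∧
      (∑ k ∈ Finset.range n, u k) ^ (n + 1) = 0 := by
  induction n with
  | zero => simp
  | succ n ih =>
    have hc : Commute (∑ k ∈ Finset.range n, u k) (u n) := Commute.sum_left _ _ _ fun i _ => h i n
    rw [Finset.sum_range_succ, add_pow_succ_of_sq hc (hu n), add_pow_succ_of_sq hc (hu n),
      pow_succ _ (n + 1), ih.2, ih.1, List.range_succ, List.map_append, List.prod_append,
      Nat.factorial_succ]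
    simp [mul_assoc]

/-- The element `e_0 ⊗ e_0 + ⋯ + e_{n-1} ⊗ e_{n-1}`. -/
def uSum (K : Type) [Field K] (n : ℕ) : A K := ∑ k ∈ Finset.range n, tProd K ([k], [k])

lemma tProd_list_map (f : ℕ → List ℕ × List ℕ) : ∀ l : List ℕ,
    (l.map fun i => tProd K (f i)).prod =
      tProd K (l.flatMap fun i => (f i).1, l.flatMap fun i => (f i).2)
  | [] => by simp [tProd, eProd, Algebra.TensorProduct.one_def]
  | i :: l => by
    rw [List.map_cons, List.prod_cons, tProd_list_map f l, tProd_mul_tProd]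
    simp

lemma uSum_pow (n : ℕ) :
    uSum K n ^ n = (n.factorial : A K) * tProd K (List.range n, List.range n) := by
  have hu : ∀ i, tProd K ([i], [i]) * tProd K ([i], [i]) = 0 := fun i => by
    have : eProd K [i, i] = 0 := by
      simp only [eProd, List.map_cons, List.map_nil, List.prod_cons, List.prod_nil, mul_one]
      exact ExteriorAlgebra.ι_sq_zero _
    rw [tProd_mul_tProd]
    simp [tProd, this]
  have hc : ∀ i j, Commute (tProd K ([i], [i])) (tProd K ([j], [j])) := fun i j => by
    have := tProd_comm (K := K) ([i], [i]) ([j], [j])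
    simpa [Commute, SemiconjBy] using this
  rw [uSum, (sum_range_pow hc hu n).1, tProd_list_map]
  simp

/-- The value of the part of a normal form without scalars. -/
lemma value_ne_zero [CharZero K] {lS lT : List ℕ} (n : ℕ) (hS : lS.Nodup) (hT : lT.Nodup) :
    (lS.map fun i => tProd K ([n + i], [])).prod * uSum K n ^ n *
      (lT.map fun i => tProd K ([], [n + i])).prod ≠ 0 := by
  have nodup : ∀ l : List ℕ, l.Nodup → (l.map (n + ·)).Nodup := fun l h =>
    h.map (add_right_injective n)
  have disj : ∀ l : List ℕ, List.Disjoint (l.map (n + ·)) (List.range n) := fun l i hi hi' => by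
    obtain ⟨j, -, rfl⟩ := List.mem_map.1 hi
    simp at hi'
  have flatMap_nil : ∀ l : List ℕ, (l.flatMap fun _ => ([] : List ℕ)) = [] := fun l => by simp
  have hcast : ∀ (m : ℕ) (x : A K), (m : A K) * x = (m : K) • x := fun m x => by
    rw [← nsmul_eq_mul, Nat.cast_smul_eq_nsmul]
  rw [uSum_pow, tProd_list_map, tProd_list_map, hcast, mul_smul_comm, smul_mul_assoc,
    tProd_mul_tProd, tProd_mul_tProd]
  refine smul_ne_zero (Nat.cast_ne_zero.2 n.factorial_ne_zero) (tProd_ne_zero ?_ ?_)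
  · simpa [flatMap_nil, ← List.map_eq_flatMap] using
      (nodup lS hS).append List.nodup_range (disj lS)
  · simpa [flatMap_nil, ← List.map_eq_flatMap] using
      List.nodup_range.append (nodup lT hT) (disj lT).symm

end Nonvanishing

section LeadingPart

open Polynomial

variable {B : Type*} [Ring B] {p w : Bool × ℕ → B}

/-- The number of variables outside brackets. -/
def outer (m : Idx) : ℕ := m.1.length + m.2.2.2.length

/-- The leading coefficient of `nf (X p + w) m`. -/
def lead (p w : Bool × ℕ → B) (m : Idx) : B :=
  vpr p false m.1 * (2 ^ ((letters m).length / 2) * ((letters m).map w).prod) *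
    vpr p true m.2.2.2

/-- The family `X p + w` of polynomials. -/
def pencil (p w : Bool × ℕ → B) (u : Bool × ℕ) : B[X] := C (p u) * X + C (w u)

lemma Split.hpr (h : Split p w) : ∀ L : List (Bool × ℕ), Even L.length →
    hpr (p + w) L = 2 ^ (L.length / 2) * (L.map w).prod
  | [], _ => by simp [Paper.hpr]
  | [_], hL => by simp at hL
  | u :: v :: L, hL => by
    have hL' : Even L.length := by simpa [Nat.even_add_one] using hL
    have h2 : Commute (w u * w v) (2 ^ (L.length / 2) : B) := (Commute.ofNat_right _ 2).pow_right _
    rw [Paper.hpr, h.sbr, h.hpr L hL', mul_assoc, ← mul_assoc (w u * w v), h2.eq]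
    have h3 : (u :: v :: L).length / 2 = L.length / 2 + 1 := by simp only [List.length_cons]; omega
    rw [h3, pow_succ', List.map_cons, List.map_cons, List.prod_cons, List.prod_cons]
    simp only [mul_assoc]

lemma Split.pencil (h : Split p w) : Split (fun u => C (p u) * X) fun u => C (w u) where
  central_p i v := ((h.central_p i v).map C |>.mul_right (commute_X _).symm).mul_left
    ((commute_X _).mul_right (commute_X _))
  central_w i v := ((h.central_w i v).map C).mul_left (commute_X _)
  anti_w i v := by simpa using (h.anti_w i v).map C
  comm_wp i j := ((h.comm_wp i j).map C).mul_right (commute_X _).symm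
  anti_pp i j := by
    have := ((h.anti_pp i j).map C).mul_right (commute_X (C (p (true, i)))).symm
    have := this.mul_left ((commute_X _).mul_right (commute_X _))
    simpa using this
  anti_wp i j := by
    have := ((h.anti_wp i j).map C).mul_right (commute_X (C (w (true, i)))).symm
    simpa using this
  comm_ww i j := (h.comm_ww i j).map C

lemma natDegree_pencil_le (u : Bool × ℕ) : (pencil p w u).natDegree ≤ 1 := natDegree_linear_le

lemma natDegree_vpr_pencil_le (b : Bool) (l : List ℕ) :
    (vpr (pencil p w) b l).natDegree ≤ l.length := by
  induction l with
  | nil => simp [vpr]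
  | cons i l ih =>
    rw [vpr_cons, List.length_cons, add_comm]
    exact natDegree_mul_le_of_le (natDegree_pencil_le _) ih

lemma coeff_vpr_pencil (b : Bool) (l : List ℕ) :
    (vpr (pencil p w) b l).coeff l.length = vpr p b l := by
  induction l with
  | nil => simp [vpr]
  | cons i l ih =>
    rw [vpr_cons, List.length_cons, add_comm,
      coeff_mul_add_eq_of_natDegree_le (natDegree_pencil_le _) (natDegree_vpr_pencil_le b l), ih,
      vpr_cons]
    simp [pencil]

lemma Split.hpr_pencil (h : Split p w) {L : List (Bool × ℕ)} (hL : Even L.length) :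
    Paper.hpr (Paper.pencil p w) L = C (2 ^ (L.length / 2) * (L.map w).prod) := by
  have := h.pencil.hpr L hL
  rw [show Paper.pencil p w = (fun u => C (p u) * X) + fun u => C (w u) from rfl, this]
  rw [C_mul, C_pow, map_ofNat C 2, map_list_prod, List.map_map]
  rfl

lemma Split.natDegree_nf_le (h : Split p w) {m : Idx} (hm : Good m) :
    (nf (Paper.pencil p w) m).natDegree ≤ outer m := by
  rw [nf, h.hpr_pencil hm.even]
  exact natDegree_mul_le_of_le (natDegree_mul_le_of_le (natDegree_vpr_pencil_le _ _)
    (natDegree_C _).le) (natDegree_vpr_pencil_le _ _)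

lemma Split.coeff_nf (h : Split p w) {m : Idx} (hm : Good m) :
    (nf (Paper.pencil p w) m).coeff (outer m) = lead p w m := by
  rw [nf, h.hpr_pencil hm.even, outer, coeff_mul_add_eq_of_natDegree_le
    ((natDegree_mul_C_le _ _).trans (natDegree_vpr_pencil_le _ _))
    (natDegree_vpr_pencil_le _ _), coeff_mul_C, coeff_vpr_pencil, coeff_vpr_pencil, lead]

variable {K : Type*} [Field K] [Algebra K B]

lemma eq_zero_of_eval_algebraMap [Infinite K] {F : B[X]}
    (h : ∀ κ : K, F.eval (algebraMap K B κ) = 0) : F = 0 := by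
  ext n
  rw [coeff_zero, ← Module.forall_dual_apply_eq_zero_iff K]
  intro φ
  set G : K[X] := ∑ k ∈ F.support, monomial k (φ (F.coeff k)) with hG
  have h0 : G = 0 := Polynomial.funext fun κ => by
    have := congrArg φ (h κ)
    rw [eval_eq_sum, Polynomial.sum, map_sum, map_zero] at this
    rw [eval_zero, ← this, hG, eval_finsetSum]
    refine Finset.sum_congr rfl fun k _ => ?_
    rw [eval_monomial, ← map_pow, ← Algebra.commutes, ← Algebra.smul_def, map_smul, smul_eq_mul,
      mul_comm]
  have : G.coeff n = φ (F.coeff n) := by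
    simp only [hG, finsetSum_coeff, coeff_monomial]
    rw [Finset.sum_ite_eq' F.support n]
    split_ifs with hn
    · rfl
    · rw [notMem_support_iff.1 hn, map_zero]
  rw [← this, h0, coeff_zero]

lemma Split.sum_lead_eq_zero [Infinite K] (h : Split p w) {c : Idx →₀ K}
    (hc : ∀ m ∈ c.support, Good m)
    (h0 : ∀ κ : K, ∑ m ∈ c.support, c m • nf (fun u => κ • p u + w u) m = 0) {n : ℕ}
    (hn : ∀ m ∈ c.support, outer m ≤ n) :
    ∑ m ∈ c.support with outer m = n, c m • lead p w m = 0 := by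
  have hF : ∑ m ∈ c.support, c m • nf (Paper.pencil p w) m = 0 := by
    refine eq_zero_of_eval_algebraMap (K := K) fun κ => ?_
    let e : B[X] →ₐ[K] B := eval₂AlgHom (AlgHom.id K B) (algebraMap K B κ)
      fun a => Algebra.commutes' _ _ |>.symm
    change e _ = 0
    rw [map_sum, ← h0 κ]
    refine Finset.sum_congr rfl fun m _ => ?_
    rw [map_smul, map_nf]
    congr 2
    ext u
    simp [e, Paper.pencil, eval₂AlgHom, Algebra.smul_def, Algebra.commutes]
  have := congrArg (fun F => F.coeff n) hF
  simp only [finsetSum_coeff, coeff_smul, coeff_zero] at this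
  rw [← this, Finset.sum_filter]
  refine Finset.sum_congr rfl fun m hm => ?_
  split_ifs with he
  · rw [← he, h.coeff_nf (hc m hm)]
  · rw [coeff_eq_zero_of_natDegree_lt, smul_zero]
    exact (h.natDegree_nf_le (hc m hm)).trans_lt (lt_of_le_of_ne (hn m hm) he)

end LeadingPart

section Coding

/-- The four lists of an index as a single list of coloured letters. -/
def code (m : Idx) : List (Fin 4 × ℕ) :=
  m.1.map (Prod.mk 0) ++ m.2.1.map (Prod.mk 1) ++ m.2.2.1.map (Prod.mk 2) ++
    m.2.2.2.map (Prod.mk 3)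

lemma eq_of_code_perm {m m' : Idx} (hm : Good m) (hm' : Good m') (h : (code m).Perm (code m')) :
    m = m' := by
  have key : ∀ (j : Fin 4) (m : Idx), ((code m).filter (fun x => x.1 = j)).map Prod.snd =
      if j = 0 then m.1 else if j = 1 then m.2.1 else if j = 2 then m.2.2.1 else m.2.2.2 := by
    intro j m
    fin_cases j <;> simp [code, List.filter_map, Function.comp_def]
  have perm := fun j : Fin 4 => (h.filter fun x => x.1 = j).map Prod.snd
  simp only [key] at perm
  obtain ⟨a, b, c, d⟩ := m
  obtain ⟨a', b', c', d'⟩ := m'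
  have h0 : a = a' := (show a.Perm a' from perm 0).eq_of_pairwise' hm.sorted_y hm'.sorted_y
  have h1 : b = b' := (show b.Perm b' from perm 1).eq_of_pairwise' hm.sorted_by hm'.sorted_by
  have h2 : c = c' := (show c.Perm c' from perm 2).eq_of_pairwise' hm.sorted_bz hm'.sorted_bz
  have h3 : d = d' := (show d.Perm d' from perm 3).eq_of_pairwise' hm.sorted_z hm'.sorted_z
  rw [h0, h1, h2, h3]

variable {K V : Type*} [Field K] [Infinite K] [AddCommGroup V] [Module K V]

lemma eq_zero_of_sum_code_smul {s : Finset Idx} (hs : ∀ m ∈ s, Good m) {v : Idx → V}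
    (h : ∀ val : Fin 4 × ℕ → K, ∑ m ∈ s, ((code m).map val).prod • v m = 0) :
    ∀ m ∈ s, v m = 0 := by
  intro m hm
  rw [← Module.forall_dual_apply_eq_zero_iff K]
  intro φ
  have h0 : ∑ m' ∈ s, MvPolynomial.monomial (Multiset.toFinsupp (↑(code m') : Multiset (Fin 4 × ℕ)))
      (φ (v m')) = 0 := by
    refine MvPolynomial.funext fun val => ?_
    have := congrArg φ (h val)
    rw [map_sum, map_zero] at this
    rw [map_sum, map_zero, ← this]
    refine Finset.sum_congr rfl fun m' _ => ?_
    rw [MvPolynomial.eval_monomial, map_smul, smul_eq_mul, mul_comm, Finsupp.prod,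
      ← Multiset.prod_coe, ← Multiset.map_coe, Finset.prod_multiset_map_count]
    rfl
  have := congrArg (MvPolynomial.coeff (Multiset.toFinsupp (↑(code m) : Multiset (Fin 4 × ℕ)))) h0
  rw [MvPolynomial.coeff_sum, MvPolynomial.coeff_zero, Finset.sum_eq_single m] at this
  · simpa using this
  · intro m' hm' hne
    rw [MvPolynomial.coeff_monomial, if_neg]
    intro he
    exact hne (eq_of_code_perm (hs m' hm') (hs m hm) (Multiset.coe_eq_coe.1
      (Multiset.toFinsupp.injective he)))
  · exact fun hm' => absurd hm hm'

end Coding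

section Main

variable {K : Type} [Field K]

/-- The component of degree `(0, 0)` or `(0, 1)` of the generic element for a variable. -/
def genericP (n : ℕ) (val : Fin 4 × ℕ → K) : Bool × ℕ → A K
  | (false, i) => val (0, i) • 1
  | (true, i) => val (3, i) • tProd K ([], [n + i])

/-- The component of degree `(1, 0)` or `(1, 1)` of the generic element for a variable. -/
def genericW (n : ℕ) (val : Fin 4 × ℕ → K) : Bool × ℕ → A K
  | (false, i) => val (1, i) • tProd K ([n + i], [])
  | (true, i) => val (2, i) • uSum K n

lemma tProd_nil : tProd K ([], []) = 1 := by
  simp [tProd, eProd, Algebra.TensorProduct.one_def]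

lemma tProd_mem_biComp (q : List ℕ × List ℕ) :
    tProd K q ∈ biComp K ((q.1.length : ZMod 2), (q.2.length : ZMod 2)) :=
  Submodule.subset_span ⟨q, rfl, rfl⟩

lemma split_generic (n : ℕ) (val : Fin 4 × ℕ → K) : Split (genericP n val) (genericW n val) := by
  refine split_of_mem ?_ ?_ <;> rintro (_ | _) i <;> refine Submodule.smul_mem _ _ ?_
  · simpa [tProd_nil] using tProd_mem_biComp (K := K) ([], [])
  · simpa using tProd_mem_biComp (K := K) ([], [n + i])
  · simpa using tProd_mem_biComp (K := K) ([n + i], [])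
  · exact Submodule.sum_mem _ fun k _ => by simpa using tProd_mem_biComp (K := K) ([k], [k])

lemma tProd_sort_mem_A0star (q : Finset ℕ × Finset ℕ) :
    tProd K (q.1.sort, q.2.sort) ∈ A0star K q.2.card :=
  Submodule.subset_span ⟨q, by simp [wdeg, wKstar, wK], (bEE_eq q).symm⟩

lemma generic_mem (n : ℕ) (val : Fin 4 × ℕ → K) (b : Bool) (i : ℕ) :
    genericP n val (b, i) ∈ A0star K (if b then 1 else 0) ∧
      genericW n val (b, i) ∈ A0star K (if b then 1 else 0) := by
  cases b <;> constructor <;> refine Submodule.smul_mem _ _ ?_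
  · simpa [tProd_nil] using tProd_sort_mem_A0star (K := K) (∅, ∅)
  · simpa using tProd_sort_mem_A0star (K := K) ({n + i}, ∅)
  · simpa using tProd_sort_mem_A0star (K := K) (∅, {n + i})
  · exact Submodule.sum_mem _ fun k _ => by simpa using tProd_sort_mem_A0star (K := K) ({k}, {k})

lemma prod_map_smul {B : Type*} [Ring B] [Algebra K B] {α : Type*} (s : α → K) (b : α → B) :
    ∀ l : List α, (l.map fun i => s i • b i).prod = (l.map s).prod • (l.map b).prod
  | [] => by simp
  | i :: l => by simp [prod_map_smul s b l, smul_smul, mul_comm]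

/-- The leading coefficient of a normal form at the generic elements, without scalars. -/
def value (n : ℕ) (m : Idx) : A K :=
  (m.2.1.map fun i => tProd K ([n + i], [])).prod * uSum K n ^ m.2.2.1.length *
    (m.2.2.2.map fun i => tProd K ([], [n + i])).prod

lemma lead_generic (n : ℕ) (val : Fin 4 × ℕ → K) (m : Idx) :
    lead (genericP n val) (genericW n val) m =
      ((code m).map val).prod • ((2 : K) ^ ((letters m).length / 2) • value n m) := by
  have h2 : (2 : A K) ^ ((letters m).length / 2) =
      algebraMap K (A K) (2 ^ ((letters m).length / 2)) := by rw [map_pow, map_ofNat]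
  have hy : vpr (genericP n val) false m.1 = (m.1.map fun i => val (0, i)).prod • 1 := by
    simpa [vpr, genericP] using prod_map_smul (fun i => val (0, i)) (fun _ => (1 : A K)) m.1
  have hz : vpr (genericP n val) true m.2.2.2 = (m.2.2.2.map fun i => val (3, i)).prod •
      (m.2.2.2.map fun i => tProd K ([], [n + i])).prod :=
    prod_map_smul (fun i => val (3, i)) _ m.2.2.2
  have hl : ((letters m).map (genericW n val)).prod =
      ((m.2.1.map fun i => val (1, i)).prod • (m.2.1.map fun i => tProd K ([n + i], [])).prod) *
        ((m.2.2.1.map fun i => val (2, i)).prod • uSum K n ^ m.2.2.1.length) := by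
    rw [letters, List.map_append, List.prod_append, List.map_map, List.map_map]
    refine congr_arg₂ _ (prod_map_smul (fun i => val (1, i)) _ m.2.1) ?_
    simpa [genericW, Function.comp_def] using
      prod_map_smul (fun i => val (2, i)) (fun _ => uSum K n) m.2.2.1
  rw [lead, h2, hy, hz, hl, ← Algebra.smul_def]
  simp only [smul_mul_assoc, mul_smul_comm, one_mul, smul_smul, code, value, List.map_append,
    List.prod_append, List.map_map, Function.comp_def]
  congr 1
  ring

/-- The normal forms are linearly independent modulo the identities of `E ⊗ E`. -/
lemma eq_zero_of_gIdent [CharZero K] {c : Idx →₀ K} (hc : ∀ m ∈ c.support, Good m)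
    (h : GIdent K (A0star K 0) (A0star K 1)
      (∑ m ∈ c.support, c m • nf (FreeAlgebra.ι K) m)) : c = 0 := by
  by_contra hne
  obtain ⟨m, hm, hmax⟩ := c.support.exists_max_image outer (Finsupp.support_nonempty_iff.2 hne)
  set n := m.2.2.1.length with hn
  have key : ∀ val : Fin 4 × ℕ → K, ∑ m' ∈ c.support with outer m' = outer m,
      ((code m').map val).prod •
        (c m' • (2 : K) ^ ((letters m').length / 2) • value (K := K) n m') = 0 := by
    intro val
    rw [← (split_generic n val).sum_lead_eq_zero hc (fun κ => ?_) hmax]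
    · refine Finset.sum_congr rfl fun m' _ => ?_
      rw [lead_generic, smul_comm]
    · have mem : ∀ b i, κ • genericP n val (b, i) + genericW n val (b, i) ∈
          A0star K (if b then 1 else 0) := fun b i =>
        Submodule.add_mem _ (Submodule.smul_mem _ _ (generic_mem n val b i).1)
          (generic_mem n val b i).2
      have := h _ _ (mem false) (mem true)
      rw [map_sum] at this
      rw [← this]
      refine Finset.sum_congr rfl fun m' _ => ?_
      rw [map_smul, map_nf]
      congr 2
      ext ⟨_ | _, i⟩ <;> simp [ev]
  have := eq_zero_of_sum_code_smul (fun m' hm' => hc m' (Finset.mem_filter.1 hm').1) key m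
    (Finset.mem_filter.2 ⟨hm, rfl⟩)
  rw [smul_eq_zero_iff_right (Finsupp.mem_support_iff.1 hm),
    smul_eq_zero_iff_right (pow_ne_zero _ two_ne_zero)] at this
  exact value_ne_zero n ((hc m hm).sorted_by.imp ne_of_lt) ((hc m hm).sorted_z.imp ne_of_lt) this

lemma gIdent_of_mem {f : FA K} (hf : f ∈ T2IdealGen K (gens K)) :
    GIdent K (A0star K 0) (A0star K 1) f := fun _ _ ha hz =>
  ev_eq_zero_of_mem hf (fun i => A0star_le 0 (ha i)) fun i => A0star_le 1 (hz i)

lemma subset_T2IdealGen (S : Set (FA K)) : S ⊆ T2IdealGen K S := fun _ hx =>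
  (TwoSidedIdeal.mem_sInf _).2 fun _ hJ => hJ.1 hx

lemma isT2Ideal_T2IdealGen (S : Set (FA K)) : IsT2Ideal K (T2IdealGen K S) := fun φ hφ x hx =>
  (TwoSidedIdeal.mem_sInf _).2 fun J hJ => hJ.2 φ hφ x ((TwoSidedIdeal.mem_sInf _).1 hx J hJ)

/-- Every polynomial is congruent to a combination of normal forms. -/
lemma exists_sub_mem [CharZero K] (f : FA K) : ∃ c : Idx →₀ K, (∀ m ∈ c.support, Good m) ∧
    f - ∑ m ∈ c.support, c m • nf (FreeAlgebra.ι K) m ∈ T2IdealGen K (gens K) := by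
  set J := T2IdealGen K (gens K) with hJ
  let π : FA K →ₐ[K] J.ringCon.Quotient := { J.ringCon.mk' with commutes' := fun _ => rfl }
  have hπ : π = FreeAlgebra.lift K fun u => J.ringCon.mk' (FreeAlgebra.ι K u) :=
    FreeAlgebra.hom_ext (by ext u; simp; rfl)
  have hf := (varRel_of_gens_subset (subset_T2IdealGen (gens K))
    (isT2Ideal_T2IdealGen _)).rel.lift_mem_nfSpan (K := K) f
  rw [← hJ, ← hπ] at hf
  obtain ⟨c, hc, hcf⟩ := (Finsupp.mem_span_image_iff_linearCombination K).1 hf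
  refine ⟨c, fun m hm => hc hm, ?_⟩
  have h0 : π (f - ∑ m ∈ c.support, c m • nf (FreeAlgebra.ι K) m) = 0 := by
    rw [map_sub, map_sum, ← hcf, sub_eq_zero, Finsupp.linearCombination_apply, Finsupp.sum]
    refine Finset.sum_congr rfl fun m _ => ?_
    rw [map_smul, map_nf]
    rfl
  rw [TwoSidedIdeal.mem_iff]
  exact (RingCon.eq _).1 h0

end Main

/-- over a field of characteristic zero, `T₂(E_{0*} ⊗ E_0) = I`, the
`T₂`-ideal generated by the polynomials (1)–(7). -/
theorem T2_eq_I_char_zero (K : Type) [Field K] [CharZero K] :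
    ∀ f : FA K, GIdent K (A0star K 0) (A0star K 1) f ↔ f ∈ T2IdealGen K (gens K) := by
  refine fun f => ⟨fun h => ?_, gIdent_of_mem⟩
  obtain ⟨c, hc, hfc⟩ := exists_sub_mem f
  have := eq_zero_of_gIdent hc fun a z ha hz => by
    have h0 := gIdent_of_mem hfc a z ha hz
    rwa [map_sub, h a z ha hz, zero_sub, neg_eq_zero] at h0
  simpa [this] using hfc

end Paper
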